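/- arXiv:2311.11746 — 4 statements merged into one kernel-verified Lean document; each statement's English description precedes it below -/
import Mathlib

section
/- Let α : G → Aut(A) be an action of a finite group G on a simple C*-algebra A. Then α has the tracial Rokhlin property if and only if the following holds: for every ε > 0, every finite subset F ⊆ A, and all positive elements x, y, z ∈ A with x ≠ 0 and ‖z‖ = 1, there exists a family of mutually orthogonal projections (p_g)_{g∈G} in A such that p = Σ_{g∈G} p_g lies in the fixed point algebra A^α and: (1) ‖p_g a − a p_g‖ < ε for all a ∈ F and g ∈ G; (2) ‖α_g(p_h) − p_{gh}‖ < ε for all g, h ∈ G; (3) (y² − y p y − ε)₊ ≾ x in A; (4) ‖p z p‖ > 1 − ε. -/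
open Filter Topology

/-- Cuntz subequivalence `a ≾ b` in a C*-algebra. -/
def CuntzSubeq {A : Type*} [NonUnitalCStarAlgebra A] (a b : A) : Prop :=
  ∃ v : ℕ → A, Tendsto (fun n => ‖a - v n * b * star (v n)‖) atTop (nhds 0)

/-- A projection in a C*-algebra: a self-adjoint idempotent. -/
def IsProjection {A : Type*} [NonUnitalCStarAlgebra A] (p : A) : Prop :=
  IsSelfAdjoint p ∧ p * p = p

/-- A C*-algebra is simple if it is nonzero and its only closed two-sided ideals
are `⊥` and `⊤`. -/
def IsSimpleCStarAlgebra (A : Type*) [NonUnitalCStarAlgebra A] : Prop :=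
  (∃ a : A, a ≠ 0) ∧ ∀ I : TwoSidedIdeal A, IsClosed (I : Set A) → I = ⊥ ∨ I = ⊤

/-- `(c - ε)₊`, via the (non-unital) continuous functional calculus. -/
noncomputable def cutPos {A : Type*} [NonUnitalCStarAlgebra A] (c : A) (ε : ℝ) : A :=
  cfcₙ (fun t : ℝ => max (t - ε) 0) c

/-- The tracial Rokhlin property for an action of a finite group `G` on a C*-algebra `A`. -/
def TracialRokhlinProperty {A : Type*} [NonUnitalCStarAlgebra A] [PartialOrder A]
    [StarOrderedRing A] {G : Type*} [Group G] [Fintype G]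
    (α : G → A ≃⋆ₐ[ℂ] A) : Prop :=
  ∀ (F : Finset A) (ε : ℝ), 0 < ε → ∀ x y : A, 0 ≤ x → 0 ≤ y → ‖x‖ = 1 →
    ∃ p : G → A,
      (∀ g, IsProjection (p g)) ∧
      (∀ g h, g ≠ h → p g * p h = 0) ∧
      (∀ a ∈ F, ∀ g, ‖p g * a - a * p g‖ < ε) ∧
      (∀ g h, ‖α g (p h) - p (g * h)‖ < ε) ∧
      CuntzSubeq (cutPos (y * y - y * (∑ g, p g) * y) ε) x ∧
      ‖(∑ g, p g) * x * (∑ g, p g)‖ > 1 - ε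

theorem CuntzSubeq.of_forall_pos {A : Type*} [NonUnitalCStarAlgebra A] {a b : A}
    (h : ∀ ε : ℝ, 0 < ε → ∃ v : A, ‖a - v * b * star v‖ ≤ ε) : CuntzSubeq a b := by
  choose v hv using fun n : ℕ => h (1 / ((n : ℝ) + 1)) (by positivity)
  exact ⟨v, squeeze_zero (fun _ => norm_nonneg _) hv tendsto_one_div_add_atTop_nhds_zero_nat⟩

theorem CuntzSubeq.exists_norm_le {A : Type*} [NonUnitalCStarAlgebra A] {a b : A}
    (h : CuntzSubeq a b) {ε : ℝ} (hε : 0 < ε) : ∃ v : A, ‖a - v * b * star v‖ ≤ ε := by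
  obtain ⟨v, hv⟩ := h
  obtain ⟨n, hn⟩ := (hv.eventually (eventually_le_nhds hε)).exists
  exact ⟨v n, hn⟩

theorem CuntzSubeq.of_conjugate {A : Type*} [NonUnitalCStarAlgebra A] {a b c : A}
    (h : CuntzSubeq a (c * b * star c)) : CuntzSubeq a b := by
  obtain ⟨v, hv⟩ := h
  refine ⟨fun n => v n * c, hv.congr fun n => ?_⟩
  simp only [star_mul, mul_assoc]

theorem cfcₙ_mul_self_mul {A : Type*} [NonUnitalCStarAlgebra A] {a : A} (ha : IsSelfAdjoint a)
    {f g : ℝ → ℝ} (hf : Continuous f) (hf0 : f 0 = 0) (hg : Continuous g) (hg0 : g 0 = 0) :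
    cfcₙ f a * a * cfcₙ g a = cfcₙ (fun t => f t * t * g t) a := by
  rw [cfcₙ_mul (fun t => f t * t) g a (hf.mul continuous_id).continuousOn (by rw [mul_zero])
    hg.continuousOn hg0, cfcₙ_mul f (fun t => t) a hf.continuousOn hf0 continuous_id.continuousOn rfl,
    cfcₙ_id' ℝ a ha]

theorem cfcₙ_mul_self {A : Type*} [NonUnitalCStarAlgebra A] {a : A} (ha : IsSelfAdjoint a)
    {f : ℝ → ℝ} (hf : Continuous f) (hf0 : f 0 = 0) :
    cfcₙ f a * a = cfcₙ (fun t => f t * t) a := by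
  rw [cfcₙ_mul f (fun t => t) a hf.continuousOn hf0 continuous_id.continuousOn rfl,
    cfcₙ_id' ℝ a ha]

theorem self_mul_cfcₙ {A : Type*} [NonUnitalCStarAlgebra A] {a : A} (ha : IsSelfAdjoint a)
    {f : ℝ → ℝ} (hf : Continuous f) (hf0 : f 0 = 0) :
    a * cfcₙ f a = cfcₙ (fun t => t * f t) a := by
  rw [cfcₙ_mul (fun t => t) f a continuous_id.continuousOn rfl hf.continuousOn hf0,
    cfcₙ_id' ℝ a ha]

/-- If `0 ≤ a ≤ b`, then `a ≾ b`. -/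
theorem CuntzSubeq.of_le {A : Type*} [NonUnitalCStarAlgebra A] [PartialOrder A]
    [StarOrderedRing A] {a b : A} (ha : 0 ≤ a) (hab : a ≤ b) : CuntzSubeq a b := by
  refine CuntzSubeq.of_forall_pos fun ε hε => ?_
  have hb : 0 ≤ b := ha.trans hab
  have hbs : IsSelfAdjoint b := .of_nonneg hb
  set r := CFC.sqrt a with hr
  have hrr : r * r = a := CFC.sqrt_mul_sqrt_self a
  have hrs : star r = r := (IsSelfAdjoint.of_nonneg (CFC.sqrt_nonneg a)).star_eq
  obtain ⟨s, hs, hsε⟩ : ∃ s : ℝ, 0 < s ∧ ‖r‖ * Real.sqrt s ≤ ε := by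
    refine ⟨(ε / (‖r‖ + 1)) ^ 2, by positivity, ?_⟩
    rw [Real.sqrt_sq (by positivity), mul_div_assoc', div_le_iff₀ (by positivity)]
    nlinarith
  have hden : ∀ t : ℝ, 0 < t ^ 2 + s ^ 2 := fun t => by positivity
  set φ : ℝ → ℝ := fun t => t ^ 2 / (t ^ 2 + s ^ 2) with hφ
  set f : ℝ → ℝ := fun t => Real.sqrt (t / (t ^ 2 + s ^ 2)) with hf
  have hφc : Continuous φ := by
    refine Continuous.div (by fun_prop) (by fun_prop) fun t => (hden t).ne'
  have hfc : Continuous f := by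
    refine Real.continuous_sqrt.comp ?_
    refine Continuous.div (by fun_prop) (by fun_prop) fun t => (hden t).ne'
  have hφ0 : φ 0 = 0 := by simp [hφ]
  have hf0 : f 0 = 0 := by simp [hf]
  set P := cfcₙ φ b with hP
  set K := cfcₙ f b with hK
  have hPs : star P = P := (cfcₙ_predicate φ b : IsSelfAdjoint _).star_eq
  have hKs : star K = K := (cfcₙ_predicate f b : IsSelfAdjoint _).star_eq
  have hKP : K * b * K = P := by
    rw [hK, cfcₙ_mul_self_mul hbs hfc hf0 hfc hf0]
    refine cfcₙ_congr fun t ht => ?_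
    have ht0 : 0 ≤ t := quasispectrum_nonneg_of_nonneg b hb t ht
    have : f t * f t = t / (t ^ 2 + s ^ 2) := Real.mul_self_sqrt (by positivity)
    calc f t * t * f t = (f t * f t) * t := by ring
      _ = φ t := by rw [this]; simp only [hφ]; ring
  have hcut : ∀ x : A, 0 ≤ x → 0 ≤ x - P * x - x * P + P * x * P := by
    intro x hx
    have h1 : CFC.sqrt x * CFC.sqrt x = x := CFC.sqrt_mul_sqrt_self x
    have h2 : star (CFC.sqrt x) = CFC.sqrt x :=
      (IsSelfAdjoint.of_nonneg (CFC.sqrt_nonneg x)).star_eq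
    have h3 := mul_star_self_nonneg (CFC.sqrt x - P * CFC.sqrt x)
    have h4 : (CFC.sqrt x - P * CFC.sqrt x) * star (CFC.sqrt x - P * CFC.sqrt x)
        = x - P * x - x * P + P * x * P := by
      nth_rewrite 5 6 7 8 [← h1]
      rw [star_sub, star_mul, h2, hPs]
      noncomm_ring
    rwa [h4] at h3
  have hbP : ‖b - P * b - b * P + P * b * P‖ ≤ s := by
    have : b - P * b - b * P + P * b * P = cfcₙ (fun t => t - φ t * t - t * φ t + φ t * t * φ t) b := by
      have hc1 : Continuous fun t => φ t * t := hφc.mul continuous_id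
      have hc2 : Continuous fun t => t * φ t := continuous_id.mul hφc
      rw [hP, cfcₙ_mul_self_mul hbs hφc hφ0 hφc hφ0, cfcₙ_mul_self hbs hφc hφ0,
        self_mul_cfcₙ hbs hφc hφ0,
        cfcₙ_add (fun t => t - φ t * t - t * φ t) (fun t => φ t * t * φ t) b
          ((continuous_id.sub hc1).sub hc2).continuousOn (by rw [hφ0]; ring)
          (hc1.mul hφc).continuousOn (by rw [hφ0]; ring),
        cfcₙ_sub (fun t => t - φ t * t) (fun t => t * φ t) b
          (continuous_id.sub hc1).continuousOn (by rw [hφ0]; ring)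
          hc2.continuousOn (by rw [hφ0]; ring),
        cfcₙ_sub (fun t => t) (fun t => φ t * t) b
          continuous_id.continuousOn rfl hc1.continuousOn (by rw [hφ0]; ring),
        cfcₙ_id' ℝ b hbs]
    rw [this]
    refine norm_cfcₙ_le fun t ht => ?_
    have ht0 : 0 ≤ t := quasispectrum_nonneg_of_nonneg b hb t ht
    have h1 : t - φ t * t - t * φ t + φ t * t * φ t = t * s ^ 4 / (t ^ 2 + s ^ 2) ^ 2 := by
      have := (hden t).ne'
      simp only [hφ]
      field_simp
      ring
    rw [h1, Real.norm_of_nonneg (by positivity), div_le_iff₀ (by positivity)]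
    have h2 : t * s ≤ t ^ 2 + s ^ 2 := by nlinarith [sq_nonneg (t - s)]
    have h3 : s ^ 2 ≤ t ^ 2 + s ^ 2 := by nlinarith
    calc t * s ^ 4 = s * ((t * s) * s ^ 2) := by ring
      _ ≤ s * ((t ^ 2 + s ^ 2) * (t ^ 2 + s ^ 2)) := by gcongr
      _ = _ := by ring
  have haP : ‖r - P * r‖ ≤ Real.sqrt s := by
    refine Real.le_sqrt_of_sq_le ?_
    rw [sq, ← CStarRing.norm_self_mul_star]
    refine le_trans ?_ hbP
    have h1 : (r - P * r) * star (r - P * r) = a - P * a - a * P + P * a * P := by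
      rw [star_sub, star_mul, hrs, hPs, ← hrr]
      noncomm_ring
    rw [h1]
    refine CStarAlgebra.norm_le_norm_of_nonneg_of_le (hcut a ha) ?_
    have h2 := hcut (b - a) (sub_nonneg.2 hab)
    rw [← sub_nonneg]
    convert h2 using 1
    noncomm_ring
  refine ⟨r * K, ?_⟩
  have h1 : a - r * K * b * star (r * K) = r * (r - P * r) := by
    rw [star_mul, hKs, hrs, ← hKP, ← hrr]
    noncomm_ring
  rw [h1]
  exact (norm_mul_le _ _).trans ((mul_le_mul_of_nonneg_left haP (norm_nonneg _)).trans hsε)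

/-- If `‖a - b‖ < ε` with `a` self-adjoint and `b` positive, then `(a - ε)₊ ≾ b`. -/
theorem CuntzSubeq.cutPos_of_norm_sub_lt {A : Type*} [NonUnitalCStarAlgebra A] [PartialOrder A]
    [StarOrderedRing A] {a b : A} {ε : ℝ} (ha : IsSelfAdjoint a) (hb : 0 ≤ b)
    (h : ‖a - b‖ < ε) : CuntzSubeq (cutPos a ε) b := by
  set δ := ‖a - b‖ with hδ
  have hδ0 : 0 ≤ δ := norm_nonneg _
  set g : ℝ → ℝ := fun t => Real.sqrt (max (t - ε) 0 / max (t - δ) (ε - δ)) with hg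
  have hden : ∀ t : ℝ, 0 < max (t - δ) (ε - δ) := fun t => lt_max_of_lt_right (by linarith)
  have hgc : Continuous g := by
    refine Real.continuous_sqrt.comp ?_
    refine Continuous.div (by fun_prop) (by fun_prop) fun t => (hden t).ne'
  have hε : 0 < ε := hδ0.trans_lt h
  have hg0 : g 0 = 0 := by simp [hg, hε.le]
  set c := cfcₙ g a with hc
  have hcs : star c = c := (cfcₙ_predicate g a : IsSelfAdjoint _).star_eq
  have hcut : cutPos a ε = c * a * c - δ • (c * c) := by
    have hc1 : Continuous fun t => g t * g t := hgc.mul hgc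
    have hc2 : Continuous fun t => g t * t * g t := (hgc.mul continuous_id).mul hgc
    rw [hc, cfcₙ_mul_self_mul ha hgc hg0 hgc hg0,
      ← cfcₙ_mul g g a hgc.continuousOn hg0 hgc.continuousOn hg0,
      ← cfcₙ_smul δ (fun t => g t * g t) a hc1.continuousOn (by rw [hg0]; ring),
      ← cfcₙ_sub (fun t => g t * t * g t) (fun t => δ • (g t * g t)) a hc2.continuousOn
        (by rw [hg0]; ring) (hc1.const_smul δ).continuousOn (by rw [hg0]; simp)]
    refine cfcₙ_congr fun t _ => ?_
    have h1 : g t * g t = max (t - ε) 0 / max (t - δ) (ε - δ) :=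
      Real.mul_self_sqrt (div_nonneg (le_max_right _ _) (hden t).le)
    have h2 : g t * t * g t - δ • (g t * g t) = (g t * g t) * (t - δ) := by
      simp only [smul_eq_mul]; ring
    change max (t - ε) 0 = g t * t * g t - δ • (g t * g t)
    rw [h2, h1]
    rcases le_total t ε with hle | hle
    · rw [max_eq_right (by linarith)]; simp
    · rw [max_eq_left (a := t - δ) (by linarith), div_mul_cancel₀]
      exact (by linarith : (0 : ℝ) < t - δ).ne'
  refine CuntzSubeq.of_conjugate (c := c) (CuntzSubeq.of_le ?_ ?_)
  · exact cfcₙ_nonneg fun t _ => le_max_right _ _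
  · have h1 := CStarAlgebra.star_left_conjugate_le_norm_smul (a := c) (ha.sub (.of_nonneg hb))
    rw [hcs] at h1 ⊢
    rw [hcut, sub_le_iff_le_add]
    have h2 : c * a * c = c * (a - b) * c + c * b * c := by noncomm_ring
    rw [h2, add_comm]
    gcongr

/-- A simple C*-algebra is prime: nonzero elements do not annihilate each other. -/
theorem IsSimpleCStarAlgebra.exists_mul_mul_ne_zero {A : Type*} [NonUnitalCStarAlgebra A]
    (hA : IsSimpleCStarAlgebra A) {c x : A} (hc : c ≠ 0) (hx : x ≠ 0) (hxs : IsSelfAdjoint x) :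
    ∃ w : A, c * w * x ≠ 0 := by
  by_contra! h
  let I : TwoSidedIdeal A := TwoSidedIdeal.mk' {a : A | ∀ w, a * w * x = 0}
    (by simp)
    (fun ha hb w => by rw [add_mul, add_mul, ha w, hb w, add_zero])
    (fun ha w => by rw [neg_mul, neg_mul, ha w, neg_zero])
    (fun {a b} hb w => by rw [mul_assoc a, mul_assoc a, hb w, mul_zero])
    (fun {a b} ha w => by rw [mul_assoc a, ha])
  have hI : (I : Set A) = {a : A | ∀ w, a * w * x = 0} := TwoSidedIdeal.coe_mk' ..
  have hclosed : IsClosed (I : Set A) := by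
    rw [hI, Set.ofPred_forall]
    exact isClosed_iInter fun w => isClosed_eq (by fun_prop) continuous_const
  rcases hA.2 I hclosed with h0 | h1
  · have : c ∈ (I : Set A) := by rw [hI]; exact h
    rw [h0] at this
    exact hc (by simpa using this)
  · have : x ∈ (I : Set A) := by rw [h1]; trivial
    rw [hI] at this
    have h2 : x * x * x = 0 := this x
    have h3 : (x * x) * star (x * x) = 0 := by
      rw [star_mul, hxs.star_eq, ← mul_assoc, h2, zero_mul]
    have h4 : x * star x = 0 := by
      rw [hxs.star_eq]; exact CStarRing.mul_star_self_eq_zero_iff _ |>.1 h3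
    exact hx (CStarRing.mul_star_self_eq_zero_iff _ |>.1 h4)

/-- In a simple C*-algebra, given a nonzero positive `x` and a positive `z` of norm one, there is
a positive norm-one `d = c x c*` lying, up to `δ`, below `z`. -/
theorem IsSimpleCStarAlgebra.exists_conjugate_le {A : Type*} [NonUnitalCStarAlgebra A]
    [PartialOrder A] [StarOrderedRing A] (hA : IsSimpleCStarAlgebra A) {x z : A} (hx : 0 ≤ x)
    (hz : 0 ≤ z) (hx0 : x ≠ 0) (hz1 : ‖z‖ = 1) {δ : ℝ} (hδ : 0 < δ) (hδ1 : δ < 1) :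
    ∃ d c : A, 0 ≤ d ∧ ‖d‖ = 1 ∧ d = c * x * star c ∧ (1 - δ) • d ≤ z := by
  have hzs : IsSelfAdjoint z := .of_nonneg hz
  set f : ℝ → ℝ := fun t => max (t - (1 - δ / 2)) 0 with hf
  set g : ℝ → ℝ := fun t => min 1 (max 0 ((t - (1 - δ)) * (2 / δ))) with hg
  have hfc : Continuous f := by fun_prop
  have hgc : Continuous g := by fun_prop
  have hf0 : f 0 = 0 := max_eq_right (by linarith)
  have hg0 : g 0 = 0 := by
    have : (0 - (1 - δ)) * (2 / δ) ≤ 0 :=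
      mul_nonpos_of_nonpos_of_nonneg (by linarith) (by positivity)
    simp only [hg, max_eq_left this]
    norm_num
  have hgf : ∀ t, g t * f t = f t := by
    intro t
    rcases le_total t (1 - δ / 2) with h | h
    · rw [show f t = 0 from max_eq_right (by linarith), mul_zero]
    · have h1 : 1 ≤ (t - (1 - δ)) * (2 / δ) := by
        rw [mul_div_assoc', le_div_iff₀ hδ]; linarith
      rw [show g t = 1 from min_eq_left (h1.trans (le_max_right _ _)), one_mul]
  have hgz : ∀ t, 0 ≤ t → (1 - δ) * (g t * g t) ≤ t := by
    intro t ht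
    have hg1 : g t ≤ 1 := min_le_left _ _
    have hg2 : 0 ≤ g t := le_min zero_le_one (le_max_left _ _)
    rcases le_total t (1 - δ) with h | h
    · have : (t - (1 - δ)) * (2 / δ) ≤ 0 :=
        mul_nonpos_of_nonpos_of_nonneg (by linarith) (by positivity)
      have : g t = 0 := by
        simp only [hg, max_eq_left this]
        norm_num
      rw [this]; simpa using ht
    · have : g t * g t ≤ 1 := mul_le_one₀ hg1 hg2 hg1
      nlinarith
  clear_value f g
  set c := cfcₙ f z with hc
  set k := cfcₙ g z with hk
  have hcs : star c = c := (cfcₙ_predicate f z : IsSelfAdjoint _).star_eq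
  have hks : star k = k := (cfcₙ_predicate g z : IsSelfAdjoint _).star_eq
  have hkc : k * c = c := by
    rw [hk, hc, ← cfcₙ_mul g f z hgc.continuousOn hg0 hfc.continuousOn hf0]
    exact cfcₙ_congr fun t _ => hgf t
  have hck : c * k = c := by rw [← hcs, ← hks, ← star_mul, hkc]
  have hkz : (1 - δ) • (k * k) ≤ z := by
    conv_rhs => rw [← cfcₙ_id' ℝ z hzs]
    rw [hk, ← cfcₙ_mul g g z hgc.continuousOn hg0 hgc.continuousOn hg0,
      ← cfcₙ_smul (1 - δ) (fun t => g t * g t) z (hgc.mul hgc).continuousOn (by rw [hg0]; ring)]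
    exact cfcₙ_mono (fun t ht => hgz t (quasispectrum_nonneg_of_nonneg z hz t ht))
      ((hgc.mul hgc).const_smul (1 - δ)).continuousOn continuous_id.continuousOn
      (by rw [hg0]; simp) rfl
  have hc0 : c ≠ 0 := by
    intro h0
    have : ‖z‖ ≤ 1 - δ / 2 := by
      rw [← cfcₙ_id' ℝ z hzs]
      refine norm_cfcₙ_le fun t ht => ?_
      have ht0 : 0 ≤ t := quasispectrum_nonneg_of_nonneg z hz t ht
      have h1 := norm_apply_le_norm_cfcₙ f z ht hfc.continuousOn hf0 hzs
      rw [← hc, h0, norm_zero] at h1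
      have h2 : f t = 0 := norm_le_zero_iff.1 h1
      have h3 : t - (1 - δ / 2) ≤ f t := by rw [hf]; exact le_max_left _ _
      rw [Real.norm_of_nonneg ht0]
      linarith
    linarith
  obtain ⟨w, hw⟩ := hA.exists_mul_mul_ne_zero hc0 hx0 (.of_nonneg hx)
  set r := CFC.sqrt x with hr
  have hrr : r * r = x := CFC.sqrt_mul_sqrt_self x
  have hrs : star r = r := (IsSelfAdjoint.of_nonneg (CFC.sqrt_nonneg x)).star_eq
  set d₀ := c * w * x * star (c * w) with hd₀
  have hd₀r : d₀ = (c * w * r) * star (c * w * r) := by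
    rw [hd₀, ← hrr, star_mul (c * w) r, hrs]; noncomm_ring
  have hd₀pos : 0 ≤ d₀ := hd₀r ▸ mul_star_self_nonneg _
  have hd₀ne : d₀ ≠ 0 := by
    intro h0
    rw [hd₀r, CStarRing.mul_star_self_eq_zero_iff] at h0
    exact hw (by rw [← hrr, ← mul_assoc, h0, zero_mul])
  have hn : 0 < ‖d₀‖ := norm_pos_iff.2 hd₀ne
  have hkd : k * d₀ * k = d₀ := by
    rw [hd₀, star_mul, hcs]
    simp only [← mul_assoc, hkc]
    rw [mul_assoc _ c k, hck]
  refine ⟨‖d₀‖⁻¹ • d₀, √(‖d₀‖⁻¹) • (c * w), smul_nonneg (by positivity) hd₀pos, ?_, ?_, ?_⟩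
  · rw [norm_smul, norm_inv, norm_norm, inv_mul_cancel₀ hn.ne']
  · rw [star_smul, star_trivial, smul_mul_assoc, smul_mul_assoc, mul_smul_comm, smul_smul,
      Real.mul_self_sqrt (by positivity)]
  · refine le_trans (smul_le_smul_of_nonneg_left ?_ (by linarith)) hkz
    have h1 := CStarAlgebra.star_left_conjugate_le_norm_smul (a := k) (b := d₀)
      (.of_nonneg hd₀pos)
    rw [hks, hkd] at h1
    have h2 := smul_le_smul_of_nonneg_left h1 (inv_nonneg.2 hn.le)
    rwa [smul_smul, inv_mul_cancel₀ hn.ne', one_smul] at h2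

theorem IsProjection.norm_le_one {A : Type*} [NonUnitalCStarAlgebra A] {p : A}
    (hp : IsProjection p) : ‖p‖ ≤ 1 := by
  have h : ‖p‖ = ‖p‖ * ‖p‖ := by
    conv_lhs => rw [← hp.2]
    conv_lhs => rw [← hp.1.star_eq]
    rw [hp.1.star_eq, ← CStarRing.norm_star_mul_self, hp.1.star_eq]
  by_contra! hlt
  nlinarith

theorem IsProjection.eq_of_norm_sub_lt_one {A : Type*} [NonUnitalCStarAlgebra A] {p q : A}
    (hp : IsProjection p) (hq : IsProjection q) (hpq : p * q = p) (h : ‖p - q‖ < 1) : p = q := by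
  have hqp : q * p = p := by rw [← hp.1.star_eq, ← hq.1.star_eq, ← star_mul, hpq]
  have h1 : star (p - q) * (p - q) = -(p - q) := by
    rw [star_sub, hp.1.star_eq, hq.1.star_eq, sub_mul, mul_sub, mul_sub, hpq, hqp, hp.2, hq.2]
    abel
  have h2 : ‖p - q‖ = ‖p - q‖ * ‖p - q‖ := by
    rw [← CStarRing.norm_star_mul_self, h1, norm_neg]
  have h3 : ‖p - q‖ = 0 := by
    by_contra hne
    have : 0 < ‖p - q‖ := lt_of_le_of_ne (norm_nonneg _) (Ne.symm hne)
    nlinarith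
  exact sub_eq_zero.1 (norm_eq_zero.1 h3)

/-- A continuous cut-off function, equal to `0` on `t ≤ 1/3` and to `1` on `t ≥ 2/3`. -/
noncomputable def thirdCutoff (t : ℝ) : ℝ := max 0 (min 1 (3 * t - 1))

theorem continuous_thirdCutoff : Continuous thirdCutoff := by
  unfold thirdCutoff; fun_prop

theorem thirdCutoff_of_le {t : ℝ} (ht : t ≤ 1 / 3) : thirdCutoff t = 0 :=
  max_eq_left ((min_le_right _ _).trans (by linarith))

theorem thirdCutoff_of_ge {t : ℝ} (ht : 2 / 3 ≤ t) : thirdCutoff t = 1 := by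
  rw [thirdCutoff, min_eq_left (by linarith), max_eq_right zero_le_one]

theorem thirdCutoff_zero : thirdCutoff 0 = 0 := thirdCutoff_of_le (by norm_num)

theorem abs_le_or_abs_sub_one_le {t η : ℝ} (h : |t * t - t| ≤ η) (hη : η < 2 / 9) :
    (t ≤ 1 / 3 ∧ |t| ≤ 3 / 2 * η) ∨ (2 / 3 ≤ t ∧ |t - 1| ≤ 3 / 2 * η) := by
  obtain ⟨h1, h2⟩ := abs_le.1 h
  rcases le_total t (1 / 2) with ht | ht
  · have ht' : t ≤ 1 / 3 := by nlinarith
    refine .inl ⟨ht', abs_le.2 ⟨?_, ?_⟩⟩ <;> nlinarith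
  · have ht' : 2 / 3 ≤ t := by nlinarith
    refine .inr ⟨ht', abs_le.2 ⟨?_, ?_⟩⟩ <;> nlinarith

theorem abs_mul_self_sub_le_of_mem_quasispectrum {A : Type*} [NonUnitalCStarAlgebra A] {s : A}
    (hs : IsSelfAdjoint s) {η : ℝ} (h : ‖s * s - s‖ ≤ η) {t : ℝ} (ht : t ∈ quasispectrum ℝ s) :
    |t * t - t| ≤ η := by
  have hc : Continuous fun t : ℝ => t * t := by fun_prop
  have h1 : s * s - s = cfcₙ (fun t : ℝ => t * t - t) s := by
    rw [cfcₙ_sub (fun t : ℝ => t * t) (fun t => t) s hc.continuousOn (by simp)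
      continuous_id.continuousOn rfl, cfcₙ_mul (fun t : ℝ => t) (fun t => t) s
      continuous_id.continuousOn rfl continuous_id.continuousOn rfl, cfcₙ_id' ℝ s hs]
  rw [h1] at h
  exact (norm_apply_le_norm_cfcₙ (fun t : ℝ => t * t - t) s ht (by fun_prop) (by simp) hs).trans h

theorem isProjection_cfcₙ_thirdCutoff {A : Type*} [NonUnitalCStarAlgebra A] {s : A}
    (hs : IsSelfAdjoint s) {η : ℝ} (h : ‖s * s - s‖ ≤ η) (hη : η < 2 / 9) :
    IsProjection (cfcₙ thirdCutoff s) := by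
  refine ⟨cfcₙ_predicate _ _, ?_⟩
  have hc := continuous_thirdCutoff
  rw [← cfcₙ_mul _ _ s hc.continuousOn thirdCutoff_zero hc.continuousOn thirdCutoff_zero]
  refine cfcₙ_congr fun t ht => ?_
  rcases abs_le_or_abs_sub_one_le (abs_mul_self_sub_le_of_mem_quasispectrum hs h ht) hη with h | h
  · simp [thirdCutoff_of_le h.1]
  · simp [thirdCutoff_of_ge h.1]

theorem norm_cfcₙ_sub_self_le {A : Type*} [NonUnitalCStarAlgebra A] {s : A}
    (hs : IsSelfAdjoint s) {f : ℝ → ℝ} (hf : Continuous f) (hf0 : f 0 = 0) {η : ℝ}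
    (h : ∀ t ∈ quasispectrum ℝ s, |f t - t| ≤ η) : ‖cfcₙ f s - s‖ ≤ η := by
  have h1 : cfcₙ f s - s = cfcₙ (fun t => f t - t) s := by
    rw [cfcₙ_sub f (fun t => t) s hf.continuousOn hf0 continuous_id.continuousOn rfl,
      cfcₙ_id' ℝ s hs]
  rw [h1]
  exact norm_cfcₙ_le h

theorem norm_cfcₙ_thirdCutoff_sub_le {A : Type*} [NonUnitalCStarAlgebra A] {s : A}
    (hs : IsSelfAdjoint s) {η : ℝ} (h : ‖s * s - s‖ ≤ η) (hη : η < 2 / 9) :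
    ‖cfcₙ thirdCutoff s - s‖ ≤ 3 / 2 * η := by
  refine norm_cfcₙ_sub_self_le hs continuous_thirdCutoff thirdCutoff_zero fun t ht => ?_
  rcases abs_le_or_abs_sub_one_le (abs_mul_self_sub_le_of_mem_quasispectrum hs h ht) hη with h | h
  · rw [thirdCutoff_of_le h.1, zero_sub, abs_neg]; exact h.2
  · rw [thirdCutoff_of_ge h.1, abs_sub_comm]; exact h.2

/-- The function `t ↦ t ^ (-1/2)` near `1`, cut off near `0`. -/
noncomputable def invSqrtCutoff (t : ℝ) : ℝ := thirdCutoff t / √(max t (1 / 3))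

theorem continuous_invSqrtCutoff : Continuous invSqrtCutoff := by
  refine continuous_thirdCutoff.div (by fun_prop) fun t => ?_
  exact (Real.sqrt_pos.2 (lt_max_of_lt_right (by norm_num))).ne'

theorem invSqrtCutoff_of_le {t : ℝ} (ht : t ≤ 1 / 3) : invSqrtCutoff t = 0 := by
  rw [invSqrtCutoff, thirdCutoff_of_le ht, zero_div]

theorem invSqrtCutoff_of_ge {t : ℝ} (ht : 2 / 3 ≤ t) : invSqrtCutoff t = 1 / √t := by
  rw [invSqrtCutoff, thirdCutoff_of_ge ht, max_eq_left (by linarith)]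

theorem invSqrtCutoff_zero : invSqrtCutoff 0 = 0 := invSqrtCutoff_of_le (by norm_num)

theorem abs_invSqrtCutoff_sub_le {t η : ℝ} (h : |t * t - t| ≤ η) (hη : η < 2 / 9) :
    |invSqrtCutoff t - t| ≤ 3 * η := by
  rcases abs_le_or_abs_sub_one_le h hη with ⟨h1, h2⟩ | ⟨h1, h2⟩
  · rw [invSqrtCutoff_of_le h1, zero_sub, abs_neg]
    linarith [abs_nonneg t]
  · rw [invSqrtCutoff_of_ge h1]
    set u := √t with hu
    have hut : u * u = t := Real.mul_self_sqrt (by linarith)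
    have hu1 : 2 / 3 ≤ u := Real.le_sqrt_of_sq_le (by linarith)
    have h3 : 1 / u - t = (1 - u) * ((1 + u + u * u) / u) := by
      rw [← hut]; field_simp; ring
    have h4 : (1 + u + u * u) / u ≤ 2 * (1 + u) := by
      rw [div_le_iff₀ (by linarith)]; nlinarith
    have h5 : 0 ≤ (1 + u + u * u) / u := by positivity
    have h6 : |t - 1| = |1 - u| * (1 + u) := by
      have h7 : t - 1 = -((1 - u) * (1 + u)) := by rw [← hut]; ring
      rw [h7, abs_neg, abs_mul, abs_of_nonneg (show (0 : ℝ) ≤ 1 + u by linarith)]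
    rw [h3, abs_mul, abs_of_nonneg h5]
    nlinarith [abs_nonneg (1 - u), mul_le_mul_of_nonneg_left h4 (abs_nonneg (1 - u))]

theorem cfcₙ_invSqrtCutoff_mul_eq {A : Type*} [NonUnitalCStarAlgebra A] {s q : A}
    (hs : IsSelfAdjoint s) (hsq : s * q = s) :
    cfcₙ invSqrtCutoff s * q = cfcₙ invSqrtCutoff s := by
  set f : ℝ → ℝ := fun t => invSqrtCutoff t / max t (1 / 3) with hf
  have hfc : Continuous f := by
    refine continuous_invSqrtCutoff.div (by fun_prop) fun t => ?_
    exact (lt_max_of_lt_right (by norm_num) : (0 : ℝ) < max t (1 / 3)).ne'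
  have hf0 : f 0 = 0 := by simp [hf, invSqrtCutoff_zero]
  have h : cfcₙ invSqrtCutoff s = cfcₙ f s * s := by
    rw [cfcₙ_mul_self hs hfc hf0]
    refine cfcₙ_congr fun t _ => ?_
    simp only [hf]
    rcases le_total t (1 / 3) with h | h
    · simp [invSqrtCutoff_of_le h]
    · rw [max_eq_left h, div_mul_cancel₀]
      linarith
  rw [h, mul_assoc, hsq]

/-- Close projections are Murray-von Neumann equivalent via a partial isometry close to them. -/
theorem IsProjection.exists_partialIsometry {A : Type*} [NonUnitalCStarAlgebra A] {p q : A}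
    (hp : IsProjection p) (hq : IsProjection q) {η : ℝ} (h : ‖p - q‖ ≤ η) (hη : η ≤ 1 / 100) :
    ∃ v : A, star v * v = p ∧ v * star v = q ∧ ‖v - p‖ ≤ 5 * η := by
  have hps := hp.1.star_eq
  have hqs := hq.1.star_eq
  have hp1 := hp.norm_le_one
  have hq1 := hq.norm_le_one
  have hη0 : 0 ≤ η := (norm_nonneg _).trans h
  set s := q * p * q with hs
  have hss : IsSelfAdjoint s := by
    rw [IsSelfAdjoint, hs, star_mul, star_mul, hps, hqs, mul_assoc]
  have hsq : s * q = s := by rw [hs, mul_assoc, hq.2]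
  have hqs' : q * s = s := by rw [hs, ← mul_assoc, ← mul_assoc, hq.2]
  have hsq1 : ‖s - q‖ ≤ η := by
    have : s - q = q * (p - q) * q := by
      rw [mul_sub, sub_mul, hq.2, hq.2]
    rw [this]
    calc ‖q * (p - q) * q‖ ≤ ‖q‖ * ‖p - q‖ * ‖q‖ := norm_mul₃_le
      _ ≤ 1 * η * 1 := by gcongr
      _ = η := by ring
  have hs1 : ‖s‖ ≤ 1 := by
    calc ‖q * p * q‖ ≤ ‖q‖ * ‖p‖ * ‖q‖ := norm_mul₃_le
      _ ≤ 1 * 1 * 1 := by gcongr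
      _ = 1 := by ring
  have hgap : ‖s * s - s‖ ≤ η := by
    have : s * s - s = s * (s - q) := by rw [mul_sub, hsq]
    rw [this]
    calc ‖s * (s - q)‖ ≤ ‖s‖ * ‖s - q‖ := norm_mul_le _ _
      _ ≤ 1 * η := by gcongr
      _ = η := one_mul _
  have hη9 : η < 2 / 9 := by linarith
  set r := cfcₙ invSqrtCutoff s with hr
  have hrs : star r = r := (cfcₙ_predicate invSqrtCutoff s : IsSelfAdjoint _).star_eq
  have hrq : r * q = r := cfcₙ_invSqrtCutoff_mul_eq hss hsq
  have hqr : q * r = r := by rw [← hrs, ← hqs, ← star_mul, hrq]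
  have hrsr : r * s * r = cfcₙ thirdCutoff s := by
    rw [hr, cfcₙ_mul_self_mul hss continuous_invSqrtCutoff invSqrtCutoff_zero
      continuous_invSqrtCutoff invSqrtCutoff_zero]
    refine cfcₙ_congr fun t ht => ?_
    rcases abs_le_or_abs_sub_one_le (abs_mul_self_sub_le_of_mem_quasispectrum hss hgap ht) hη9
      with h | h
    · simp [invSqrtCutoff_of_le h.1, thirdCutoff_of_le h.1]
    · have hpos : 0 < t := by linarith [h.1]
      simp only [invSqrtCutoff_of_ge h.1, thirdCutoff_of_ge h.1]
      have := Real.mul_self_sqrt hpos.le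
      have h0 := (Real.sqrt_pos.2 hpos).ne'
      field_simp
      nlinarith
  have hE := isProjection_cfcₙ_thirdCutoff hss hgap hη9
  have hEq : cfcₙ thirdCutoff s = q := by
    refine hE.eq_of_norm_sub_lt_one hq (by rw [← hrsr, mul_assoc, hrq]) ?_
    have := norm_cfcₙ_thirdCutoff_sub_le hss hgap hη9
    linarith [norm_sub_le_norm_sub_add_norm_sub (cfcₙ thirdCutoff s) s q]
  have hrs3 : ‖r - s‖ ≤ 3 * η :=
    norm_cfcₙ_sub_self_le hss continuous_invSqrtCutoff invSqrtCutoff_zero fun t ht =>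
      abs_invSqrtCutoff_sub_le (abs_mul_self_sub_le_of_mem_quasispectrum hss hgap ht) hη9
  set v := r * p with hv
  have hvp : v * p = v := by rw [hv, mul_assoc, hp.2]
  have hvv : v * star v = q := by
    rw [← hEq, ← hrsr, hv, star_mul, hrs, hps, hs]
    calc r * p * (p * r) = r * (p * p) * r := by noncomm_ring
      _ = (r * q) * p * (q * r) := by rw [hp.2, hrq, hqr]
      _ = _ := by noncomm_ring
  have hv1 : ‖v‖ ≤ 1 := by
    have := CStarRing.norm_self_mul_star (x := v)
    rw [hvv] at this
    nlinarith [norm_nonneg v]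
  have hvp5 : ‖v - p‖ ≤ 5 * η := by
    have h1 : v - p = (r - p) * p := by rw [hv, sub_mul, hp.2]
    have h2 : ‖r - p‖ ≤ 5 * η := by
      have : ‖q - p‖ ≤ η := by rwa [norm_sub_rev]
      linarith [norm_sub_le_norm_sub_add_norm_sub r s p, norm_sub_le_norm_sub_add_norm_sub s q p]
    rw [h1]
    calc ‖(r - p) * p‖ ≤ ‖r - p‖ * ‖p‖ := norm_mul_le _ _
      _ ≤ 5 * η * 1 := by gcongr
      _ = 5 * η := mul_one _
  have hqv : q * v = v := by rw [hv, ← mul_assoc, hqr]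
  refine ⟨v, ?_, hvv, hvp5⟩
  refine IsProjection.eq_of_norm_sub_lt_one ⟨.star_mul_self v, ?_⟩ hp ?_ ?_
  · rw [mul_assoc, ← mul_assoc v, hvv, hqv]
  · rw [mul_assoc, hvp]
  · have h1 : star v * v - p = star v * (v - p) + star (v - p) * p := by
      rw [mul_sub, star_sub, sub_mul, hps, hp.2]
      abel
    calc ‖star v * v - p‖ ≤ ‖star v * (v - p)‖ + ‖star (v - p) * p‖ := h1 ▸ norm_add_le _ _
      _ ≤ ‖star v‖ * ‖v - p‖ + ‖star (v - p)‖ * ‖p‖ := by gcongr <;> exact norm_mul_le _ _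
      _ ≤ 1 * (5 * η) + (5 * η) * 1 := by
        rw [norm_star, norm_star]
        gcongr
      _ < 1 := by linarith

/-- A projection which is almost invariant under a finite group action is close to an invariant
projection. -/
theorem IsProjection.exists_invariant {A : Type*} [NonUnitalCStarAlgebra A] {G : Type*} [Group G]
    [Fintype G] {α : G → A ≃⋆ₐ[ℂ] A} (hα : ∀ g h : G, ∀ a : A, α (g * h) a = α g (α h a))
    {p : A} (hp : IsProjection p) {η : ℝ} (h : ∀ g, ‖α g p - p‖ ≤ η) (hη : η ≤ 1 / 100) :
    ∃ q : A, IsProjection q ∧ (∀ g, α g q = q) ∧ ‖p - q‖ ≤ 7 * η := by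
  have hη0 : 0 ≤ η := (norm_nonneg _).trans (h 1)
  have hp1 := hp.norm_le_one
  set N : ℝ := (Fintype.card G : ℝ) with hN
  have hN0 : 0 < N := by rw [hN]; exact_mod_cast Fintype.card_pos
  set a : A := N⁻¹ • ∑ g, α g p with ha
  have has : IsSelfAdjoint a := by
    refine IsSelfAdjoint.smul (.all _) ?_
    rw [IsSelfAdjoint, star_sum]
    exact Finset.sum_congr rfl fun g _ => by rw [← map_star, hp.1.star_eq]
  have hαa : ∀ g, α g a = a := by
    intro g
    rw [ha, hN, map_inv_natCast_smul (α g) ℝ ℝ, map_sum]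
    congr 1
    simp_rw [← hα]
    exact Fintype.sum_equiv (Equiv.mulLeft g) _ _ fun _ => rfl
  have hap : ‖a - p‖ ≤ η := by
    have h1 : a - p = N⁻¹ • ∑ g, (α g p - p) := by
      rw [Finset.sum_sub_distrib, smul_sub, ← ha, Finset.sum_const, Finset.card_univ,
        ← Nat.cast_smul_eq_nsmul ℝ, smul_smul, inv_mul_cancel₀ hN0.ne', one_smul]
    rw [h1, norm_smul, norm_inv, Real.norm_of_nonneg hN0.le, inv_mul_le_iff₀ hN0]
    refine (norm_sum_le_of_le _ fun g _ => h g).trans_eq ?_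
    simp [hN]
  have ha2 : ‖a‖ ≤ 2 := by
    have := norm_le_norm_add_norm_sub' a p
    linarith
  have hgap : ‖a * a - a‖ ≤ 4 * η := by
    have h1 : a * a - a = a * (a - p) + (a - p) * p + (p - a) := by
      rw [mul_sub, sub_mul, hp.2]; abel
    rw [h1]
    calc _ ≤ ‖a * (a - p)‖ + ‖(a - p) * p‖ + ‖p - a‖ := norm_add₃_le
      _ ≤ ‖a‖ * ‖a - p‖ + ‖a - p‖ * ‖p‖ + ‖a - p‖ := by
        rw [norm_sub_rev p a]
        gcongr <;> exact norm_mul_le _ _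
      _ ≤ 2 * η + η * 1 + η := by gcongr
      _ = 4 * η := by ring
  have hη9 : 4 * η < 2 / 9 := by linarith
  refine ⟨cfcₙ thirdCutoff a, isProjection_cfcₙ_thirdCutoff has hgap hη9, fun g => ?_, ?_⟩
  · have hs := NonUnitalStarAlgHomClass.map_cfcₙ (S := ℂ) (α g) thirdCutoff a
      continuous_thirdCutoff.continuousOn thirdCutoff_zero (StarAlgEquiv.isometry (α g)).continuous
      has (has.map (α g))
    rw [hs, hαa]
  · have := norm_cfcₙ_thirdCutoff_sub_le has hgap hη9
    rw [norm_sub_rev]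
    linarith [norm_sub_le_norm_sub_add_norm_sub (cfcₙ thirdCutoff a) a p]

theorem norm_sub_cutPos_le {A : Type*} [NonUnitalCStarAlgebra A] [PartialOrder A]
    [StarOrderedRing A] {a : A} (ha : 0 ≤ a) {ε : ℝ} (hε : 0 ≤ ε) : ‖a - cutPos a ε‖ ≤ ε := by
  rw [norm_sub_rev]
  refine norm_cfcₙ_sub_self_le (f := fun t => max (t - ε) 0) (.of_nonneg ha) (by fun_prop)
    (max_eq_right (by linarith)) fun t ht => ?_
  have ht0 : 0 ≤ t := quasispectrum_nonneg_of_nonneg a ha t ht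
  rcases le_total t ε with h | h
  · rw [max_eq_right (by linarith), abs_le]; constructor <;> linarith
  · rw [max_eq_left (by linarith), abs_le]; constructor <;> linarith

theorem IsProjection.sum {A : Type*} [NonUnitalCStarAlgebra A] {ι : Type*} [Fintype ι] {p : ι → A}
    (hp : ∀ i, IsProjection (p i)) (hpp : ∀ i j, i ≠ j → p i * p j = 0) :
    IsProjection (∑ i, p i) := by
  classical
  refine ⟨?_, ?_⟩
  · rw [IsSelfAdjoint, star_sum]
    exact Finset.sum_congr rfl fun i _ => (hp i).1.star_eq
  · rw [Finset.sum_mul_sum]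
    refine Finset.sum_congr rfl fun i _ => ?_
    rw [Finset.sum_eq_single i (fun j _ hj => hpp i j hj.symm) (by simp), (hp i).2]

/-- A family of mutually orthogonal projections that is approximately permuted by a finite group
action can be perturbed so that its sum is invariant. -/
theorem exists_orthogonal_projections_invariant_sum {A : Type*} [NonUnitalCStarAlgebra A]
    {G : Type*} [Group G] [Fintype G] {α : G → A ≃⋆ₐ[ℂ] A}
    (hα : ∀ g h : G, ∀ a : A, α (g * h) a = α g (α h a)) {p : G → A}
    (hp : ∀ g, IsProjection (p g)) (hpp : ∀ g h, g ≠ h → p g * p h = 0) {κ : ℝ} (hκ : κ ≤ 1 / 100)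
    (h : ∀ g h, Fintype.card G * ‖α g (p h) - p (g * h)‖ ≤ κ / 70) :
    ∃ q : G → A, (∀ g, IsProjection (q g)) ∧ (∀ g h, g ≠ h → q g * q h = 0) ∧
      (∀ g, α g (∑ k, q k) = ∑ k, q k) ∧ (∀ g, ‖p g - q g‖ ≤ κ) ∧
      ‖(∑ k, p k) - ∑ k, q k‖ ≤ κ / 10 := by
  have hP := IsProjection.sum hp hpp
  set P := ∑ k, p k with hPdef
  have hPα : ∀ g, ‖α g P - P‖ ≤ κ / 70 := by
    intro g
    have h1 : α g P - P = ∑ k, (α g (p k) - p (g * k)) := by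
      rw [Finset.sum_sub_distrib, hPdef, map_sum]
      congr 1
      exact (Fintype.sum_equiv (Equiv.mulLeft g) _ _ fun _ => rfl).symm
    have hN0 : (0 : ℝ) < Fintype.card G := by exact_mod_cast Fintype.card_pos
    rw [h1]
    refine (norm_sum_le_of_le (f := fun k => α g (p k) - p (g * k)) Finset.univ
      (n := fun _ => κ / 70 / Fintype.card G) fun k _ => ?_).trans_eq ?_
    · rw [le_div_iff₀' hN0]; exact h g k
    · rw [Finset.sum_const, Finset.card_univ, nsmul_eq_mul, mul_div_cancel₀ _ hN0.ne']
  have hκ0 : 0 ≤ κ := by linarith [(norm_nonneg _).trans (hPα 1)]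
  obtain ⟨Q, hQ, hQα, hPQ⟩ := hP.exists_invariant hα hPα (by linarith)
  obtain ⟨v, hv1, hv2, hv3⟩ := hP.exists_partialIsometry hQ hPQ (by linarith)
  have hpP : ∀ g, p g * P = p g := by
    classical
    intro g
    rw [hPdef, Finset.mul_sum, Finset.sum_eq_single g (fun j _ hj => hpp g j hj.symm) (by simp),
      (hp g).2]
  have hPp : ∀ g, P * p g = p g := fun g => by
    rw [← (hp g).1.star_eq, ← hP.1.star_eq, ← star_mul, hpP]
  have hmul : ∀ g h, v * p g * star v * (v * p h * star v) = v * (p g * p h) * star v := by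
    intro g h
    calc v * p g * star v * (v * p h * star v)
        = v * (p g * (star v * v)) * p h * star v := by noncomm_ring
      _ = v * p g * p h * star v := by rw [hv1, hpP]
      _ = _ := by noncomm_ring
  have hvnorm : ‖v‖ ≤ 1 := by
    have h1 := CStarRing.norm_self_mul_star (x := v)
    have h2 := hQ.norm_le_one
    rw [← hv2] at h2
    nlinarith [norm_nonneg v]
  have hsum : ∑ k, v * p k * star v = Q := by
    rw [← Finset.sum_mul, ← Finset.mul_sum, ← hPdef, ← hv1, ← mul_assoc, mul_assoc, hv2, hQ.2]
  refine ⟨fun g => v * p g * star v, fun g => ⟨?_, ?_⟩, fun g h hgh => ?_, fun g => ?_,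
    fun g => ?_, ?_⟩
  · exact (hp g).1.conjugate v
  · rw [hmul, (hp g).2]
  · rw [hmul, hpp g h hgh, mul_zero, zero_mul]
  · rw [hsum, hQα]
  · have h1 : v * p g * star v - p g = v * p g * star (v - P) + (v - P) * p g := by
      rw [star_sub, hP.1.star_eq, mul_sub, sub_mul, mul_assoc v _ P, hpP, hPp]
      abel
    have hpg := (hp g).norm_le_one
    rw [norm_sub_rev, h1]
    calc _ ≤ ‖v * p g * star (v - P)‖ + ‖(v - P) * p g‖ := norm_add_le _ _
      _ ≤ ‖v‖ * ‖p g‖ * ‖star (v - P)‖ + ‖v - P‖ * ‖p g‖ := by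
        gcongr
        · exact norm_mul₃_le
        · exact norm_mul_le _ _
      _ ≤ 1 * 1 * (5 * (7 * (κ / 70))) + (5 * (7 * (κ / 70))) * 1 := by
        rw [norm_star]
        gcongr
      _ = κ := by ring
  · rw [hsum]
    linarith

/-- Lemma 2.4: equivalent (seemingly stronger) form of the tracial Rokhlin property, in which the
sum of the Rokhlin projections is invariant, and conditions (3) and (4) feature two different
elements `x` and `z`. -/
theorem tracialRokhlin_iff_invariant_two_unknowns
    {A : Type*} [NonUnitalCStarAlgebra A] [PartialOrder A] [StarOrderedRing A]
    {G : Type*} [Group G] [Fintype G]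
    (hA : IsSimpleCStarAlgebra A)
    (α : G → A ≃⋆ₐ[ℂ] A) (hα : ∀ g h : G, ∀ a : A, α (g * h) a = α g (α h a)) :
    TracialRokhlinProperty α ↔
      (∀ (ε : ℝ), 0 < ε → ∀ (F : Finset A), ∀ x y z : A,
        0 ≤ x → 0 ≤ y → 0 ≤ z → x ≠ 0 → ‖z‖ = 1 →
        ∃ p : G → A,
          (∀ g, IsProjection (p g)) ∧
          (∀ g h, g ≠ h → p g * p h = 0) ∧
          (∀ g, α g (∑ k, p k) = ∑ k, p k) ∧
          (∀ a ∈ F, ∀ g, ‖p g * a - a * p g‖ < ε) ∧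
          (∀ g h, ‖α g (p h) - p (g * h)‖ < ε) ∧
          CuntzSubeq (cutPos (y * y - y * (∑ g, p g) * y) ε) x ∧
          ‖(∑ g, p g) * z * (∑ g, p g)‖ > 1 - ε) := by
  constructor
  swap
  · intro h F ε hε x y hx hy hx1
    obtain ⟨p, h1, h2, -, h3, h4, h5, h6⟩ := h ε hε F x y x hx hy hx
      (norm_ne_zero_iff.1 (by rw [hx1]; exact one_ne_zero)) hx1
    exact ⟨p, h1, h2, h3, h4, h5, h6⟩
  intro hT ε hε F x y z hx hy hz hx0 hz1
  set M := ∑ a ∈ F, ‖a‖ with hM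
  have hM0 : 0 ≤ M := Finset.sum_nonneg fun _ _ => norm_nonneg _
  set κ := min (1 / 100) (ε / (8 * (1 + M + ‖y‖ ^ 2))) with hκ
  have hκ0 : 0 < κ := lt_min (by norm_num) (by positivity)
  have hκ1 : κ ≤ 1 / 100 := min_le_left _ _
  have hκε : κ * (8 * (1 + M + ‖y‖ ^ 2)) ≤ ε := by
    rw [← le_div_iff₀ (by positivity)]; exact min_le_right _ _
  have hκM : 0 ≤ κ * M := by positivity
  have hκy : 0 ≤ κ * ‖y‖ ^ 2 := by positivity
  have hN1 : (1 : ℝ) ≤ Fintype.card G := by exact_mod_cast Fintype.card_pos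
  set ε' := κ / 70 / Fintype.card G with hε'
  have hε'0 : 0 < ε' := by positivity
  have hε'κ : ε' ≤ κ / 70 := div_le_self (by positivity) hN1
  set δ := min (1 / 2) (ε / 4) with hδ
  have hδ0 : 0 < δ := lt_min (by norm_num) (by positivity)
  have hδ1 : δ ≤ 1 / 2 := min_le_left _ _
  have hδε : δ ≤ ε / 4 := min_le_right _ _
  obtain ⟨d, c, hd0, hd1, hdc, hdz⟩ :=
    hA.exists_conjugate_le hx hz hx0 hz1 hδ0 (by linarith)
  obtain ⟨p, hp, hpp, hpF, hpα, hpy, hpd⟩ := hT F ε' hε'0 d y hd0 hy hd1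
  obtain ⟨q, hq, hqq, hqα, hpq, hPQ⟩ := exists_orthogonal_projections_invariant_sum hα hp hpp hκ1
    (fun g h => by
      have := mul_le_mul_of_nonneg_left (hpα g h).le (zero_le_one.trans hN1)
      rwa [hε', mul_div_cancel₀ _ (zero_lt_one.trans_le hN1).ne'] at this)
  have hP := IsProjection.sum hp hpp
  have hQ := IsProjection.sum hq hqq
  set P := ∑ g, p g with hPdef
  set Q := ∑ g, q g with hQdef
  have hP1 := hP.norm_le_one
  have hQ1 := hQ.norm_le_one
  refine ⟨q, hq, hqq, hqα, fun a ha g => ?_, fun g h => ?_, ?_, ?_⟩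
  · have haM : ‖a‖ ≤ M := Finset.single_le_sum (f := fun a => ‖a‖) (fun _ _ => norm_nonneg _) ha
    have h1 : q g * a - a * q g = (p g * a - a * p g) + (a * (p g - q g) - (p g - q g) * a) := by
      noncomm_ring
    rw [h1]
    calc _ ≤ ‖p g * a - a * p g‖ + (‖a * (p g - q g)‖ + ‖(p g - q g) * a‖) :=
          (norm_add_le _ _).trans (by gcongr; exact norm_sub_le _ _)
      _ ≤ ε' + (‖a‖ * ‖p g - q g‖ + ‖p g - q g‖ * ‖a‖) := by
        gcongr
        · exact (hpF a ha g).le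
        · exact norm_mul_le _ _
        · exact norm_mul_le _ _
      _ ≤ ε' + (M * κ + κ * M) := by gcongr <;> exact hpq g
      _ < ε := by linarith
  · have h1 : α g (q h) - q (g * h) =
        (α g (p h) - p (g * h)) - α g (p h - q h) + (p (g * h) - q (g * h)) := by
      rw [map_sub]; abel
    rw [h1]
    have h2 : ‖α g (p h - q h)‖ ≤ κ := (StarAlgEquiv.norm_map (α g) _).trans_le (hpq h)
    calc _ ≤ ‖α g (p h) - p (g * h)‖ + ‖α g (p h - q h)‖ + ‖p (g * h) - q (g * h)‖ :=
          (norm_add_le _ _).trans (by gcongr; exact norm_sub_le _ _)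
      _ ≤ ε' + κ + κ := by gcongr; exacts [(hpα g h).le, hpq _]
      _ < ε := by linarith
  · have hys : star y = y := (IsSelfAdjoint.of_nonneg hy).star_eq
    obtain ⟨w, hw⟩ := (hdc ▸ hpy : CuntzSubeq _ (c * x * star c)).of_conjugate.exists_norm_le hκ0
    refine CuntzSubeq.of_conjugate (c := w) (CuntzSubeq.cutPos_of_norm_sub_lt ?_
      (star_right_conjugate_nonneg hx w) ?_)
    · rw [IsSelfAdjoint, star_sub, star_mul, star_mul, star_mul, hys, hQ.1.star_eq, mul_assoc]
    · have h0 : 0 ≤ y * y - y * P * y := by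
        have h1 := star_mul_self_nonneg (y - P * y)
        have h2 : star (y - P * y) * (y - P * y) = y * y - y * P * y := by
          rw [star_sub, star_mul, hys, hP.1.star_eq]
          calc (y - y * P) * (y - P * y) = y * y - y * P * y - y * P * y + y * (P * P) * y := by
                noncomm_ring
            _ = _ := by rw [hP.2]; abel
        rwa [h2] at h1
      have h1 := norm_sub_cutPos_le h0 hε'0.le
      have h2 : ‖(y * y - y * Q * y) - (y * y - y * P * y)‖ ≤ κ * ‖y‖ ^ 2 := by
        have h3 : (y * y - y * Q * y) - (y * y - y * P * y) = y * (P - Q) * y := by noncomm_ring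
        rw [h3]
        calc _ ≤ ‖y‖ * ‖P - Q‖ * ‖y‖ := norm_mul₃_le
          _ ≤ ‖y‖ * κ * ‖y‖ := by gcongr; linarith
          _ = _ := by ring
      have h4 := norm_sub_le_norm_sub_add_norm_sub (y * y - y * Q * y) (y * y - y * P * y)
        (w * x * star w)
      have h5 := norm_sub_le_norm_sub_add_norm_sub (y * y - y * P * y)
        (cutPos (y * y - y * P * y) ε') (w * x * star w)
      linarith
  · have h1 : (1 - δ) * ‖P * d * P‖ ≤ ‖P * z * P‖ := by
      have h2 := hP.1.conjugate_le_conjugate hdz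
      have h3 := CStarAlgebra.norm_le_norm_of_nonneg_of_le
        (hP.1.conjugate_nonneg (smul_nonneg (by linarith) hd0)) h2
      rwa [mul_smul_comm, smul_mul_assoc, norm_smul, Real.norm_of_nonneg (by linarith)] at h3
    have h2 : ‖P * z * P - Q * z * Q‖ ≤ κ := by
      have h3 : P * z * P - Q * z * Q = (P - Q) * z * P + Q * z * (P - Q) := by noncomm_ring
      rw [h3]
      calc _ ≤ ‖(P - Q) * z * P‖ + ‖Q * z * (P - Q)‖ := norm_add_le _ _
        _ ≤ ‖P - Q‖ * ‖z‖ * ‖P‖ + ‖Q‖ * ‖z‖ * ‖P - Q‖ := by gcongr <;> exact norm_mul₃_le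
        _ ≤ κ / 10 * 1 * 1 + 1 * 1 * (κ / 10) := by rw [hz1]; gcongr
        _ ≤ κ := by linarith
    have h3 := norm_le_norm_add_norm_sub' (P * z * P) (Q * z * Q)
    nlinarith
end

section
/- Let A be a C*-algebra and n ∈ ℕ. For every self-adjoint matrix (a_{ij}) ∈ Mₙ(A), setting a = Σ_{i,j=1}^n |a_{ij}| (a positive element of A), one has (a_{ij}) ≤ diag(a, a, …, a) in the C*-order on Mₙ(A). -/
/-- The absolute value `|b| = (b* b)^(1/2)` of an element of a C*-algebra. -/
noncomputable def cstarAbs {A : Type*} [NonUnitalCStarAlgebra A] [PartialOrder A]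
    [StarOrderedRing A] (b : A) : A :=
  CFC.sqrt (star b * b)

/-- A matrix over a C*-algebra is positive (in the C*-algebra `Mₙ(A)`) iff it is of the form
`z* z`. -/
def MatrixIsPositive {A : Type*} [NonUnitalCStarAlgebra A] {n : ℕ}
    (m : Matrix (Fin n) (Fin n) A) : Prop :=
  ∃ z : Matrix (Fin n) (Fin n) A, m = star z * z

theorem CStarAlgebra.nonneg_iff_exists_star_mul_self {B : Type*} [NonUnitalCStarAlgebra B]
    [PartialOrder B] [StarOrderedRing B] {x : B} : 0 ≤ x ↔ ∃ z, x = star z * z :=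
  CStarAlgebra.nonneg_iff_eq_star_mul_self

theorem matrixIsPositive_iff_nonneg {A : Type*} [NonUnitalCStarAlgebra A] [PartialOrder A]
    [StarOrderedRing A] {n : ℕ} {m : Matrix (Fin n) (Fin n) A} :
    MatrixIsPositive m ↔ 0 ≤ CStarMatrix.ofMatrix m :=
  (CStarAlgebra.nonneg_iff_exists_star_mul_self (x := CStarMatrix.ofMatrix m)).symm

theorem IsSelfAdjoint.le_of_mul_self_eq {B : Type*} [NonUnitalCStarAlgebra B] [PartialOrder B]
    [StarOrderedRing B] {x y : B} (hx : IsSelfAdjoint x) (hy : 0 ≤ y) (h : y * y = x * x) :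
    x ≤ y := by
  have habs : CFC.abs x = y := CFC.sqrt_unique (by rw [h, hx.star_eq])
  rw [← sub_nonneg, ← habs, CFC.abs_sub_self x hx]
  exact nsmul_nonneg (CFC.negPart_nonneg x) 2

theorem CStarAlgebra.le_of_add_self_le_add_self {B : Type*} [NonUnitalCStarAlgebra B]
    [PartialOrder B] [StarOrderedRing B] {x y : B} (h : x + x ≤ y + y) : x ≤ y := by
  have h' := smul_le_smul_of_nonneg_left h (by norm_num : (0 : ℝ) ≤ 1 / 2)
  simpa only [← two_smul ℝ, smul_smul, one_div, ne_eq, OfNat.ofNat_ne_zero, not_false_eq_true,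
    inv_mul_cancel₀, one_smul] using h'

section

variable {A : Type*} [NonUnitalCStarAlgebra A] {n : ℕ}

theorem CStarMatrix.ofMatrix_mul (M N : Matrix (Fin n) (Fin n) A) :
    CStarMatrix.ofMatrix M * CStarMatrix.ofMatrix N = CStarMatrix.ofMatrix (M * N) := rfl

theorem CStarMatrix.star_ofMatrix (M : Matrix (Fin n) (Fin n) A) :
    star (CStarMatrix.ofMatrix M) = CStarMatrix.ofMatrix M.conjTranspose := rfl

theorem CStarMatrix.ofMatrix_sum {ι : Type*} (s : Finset ι) (f : ι → Matrix (Fin n) (Fin n) A) :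
    CStarMatrix.ofMatrix (∑ i ∈ s, f i) = ∑ i ∈ s, CStarMatrix.ofMatrix (f i) :=
  map_sum (CStarMatrix.ofMatrixₗ (R := ℂ)) f s

end

section

variable {A : Type*} [NonUnitalCStarAlgebra A] [PartialOrder A] [StarOrderedRing A] {n : ℕ}

theorem cstarAbs_nonneg (b : A) : 0 ≤ cstarAbs b := CFC.sqrt_nonneg _

theorem cstarAbs_mul_self (b : A) : cstarAbs b * cstarAbs b = star b * b :=
  CFC.sqrt_mul_sqrt_self _ (star_mul_self_nonneg b)

theorem CStarMatrix.ofMatrix_diagonal_nonneg {d : Fin n → A} (hd : 0 ≤ d) :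
    0 ≤ CStarMatrix.ofMatrix (Matrix.diagonal d) := by
  rw [← matrixIsPositive_iff_nonneg]
  choose z hz using fun i => CStarAlgebra.nonneg_iff_exists_star_mul_self.mp (hd i)
  refine ⟨Matrix.diagonal z, ?_⟩
  rw [Matrix.star_eq_conjTranspose, Matrix.diagonal_conjTranspose, Matrix.diagonal_mul_diagonal]
  exact congrArg _ (funext hz)

theorem CStarMatrix.ofMatrix_single_nonneg (i : Fin n) {c : A} (hc : 0 ≤ c) :
    0 ≤ CStarMatrix.ofMatrix (Matrix.single i i c) := by
  rw [← Matrix.diagonal_single]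
  exact ofMatrix_diagonal_nonneg (Pi.single_nonneg.mpr hc)

theorem CStarMatrix.single_add_single_star_le (i j : Fin n) {b : A}
    (hb : i = j → IsSelfAdjoint b) :
    CStarMatrix.ofMatrix (Matrix.single i j b + Matrix.single j i (star b)) ≤
      CStarMatrix.ofMatrix (Matrix.single i i (cstarAbs (star b)) +
        Matrix.single j j (cstarAbs b)) := by
  obtain rfl | hij := eq_or_ne i j
  · have hb := hb rfl
    have hle : b ≤ cstarAbs b :=
      hb.le_of_mul_self_eq (cstarAbs_nonneg b) (by rw [cstarAbs_mul_self, hb.star_eq])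
    have hsplit : Matrix.single i i (cstarAbs b) =
        Matrix.single i i (cstarAbs b - b) + Matrix.single i i b := by
      rw [← Matrix.single_add, sub_add_cancel]
    have hsingle : CStarMatrix.ofMatrix (Matrix.single i i b) ≤
        CStarMatrix.ofMatrix (Matrix.single i i (cstarAbs b)) := by
      rw [hsplit, ← CStarMatrix.of_add_of]
      exact le_add_of_nonneg_left (ofMatrix_single_nonneg i (sub_nonneg.mpr hle))
    rw [hb.star_eq, ← CStarMatrix.of_add_of, ← CStarMatrix.of_add_of]
    exact add_le_add hsingle hsingle
  · refine IsSelfAdjoint.le_of_mul_self_eq ?_ ?_ ?_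
    · rw [isSelfAdjoint_iff, star_ofMatrix, Matrix.conjTranspose_add,
        Matrix.conjTranspose_single, Matrix.conjTranspose_single, star_star, add_comm]
    · exact add_nonneg (ofMatrix_single_nonneg i (cstarAbs_nonneg _))
        (ofMatrix_single_nonneg j (cstarAbs_nonneg _))
    · simp only [ofMatrix_mul, add_mul, mul_add, Matrix.single_mul_single_same,
        Matrix.single_mul_single_of_ne _ _ _ _ hij, Matrix.single_mul_single_of_ne _ _ _ _ hij.symm,
        cstarAbs_mul_self, star_star, add_zero, zero_add]
      rw [add_comm]

theorem CStarMatrix.add_self_le_diagonal_add_diagonal {M : Matrix (Fin n) (Fin n) A}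
    (hM : IsSelfAdjoint M) :
    CStarMatrix.ofMatrix (M + M) ≤
      CStarMatrix.ofMatrix (Matrix.diagonal (fun j => ∑ i, cstarAbs (M i j)) +
        Matrix.diagonal (fun j => ∑ i, cstarAbs (M i j))) := by
  have hstar (i j : Fin n) : star (M i j) = M j i := congrFun (congrFun hM j) i
  have hdiag : Matrix.diagonal (fun j => ∑ i, cstarAbs (M i j)) =
      ∑ i, ∑ j, Matrix.single j j (cstarAbs (M i j)) := by
    rw [Finset.sum_comm]
    ext k l
    simp only [Matrix.sum_apply, Matrix.single_apply, Matrix.diagonal_apply]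
    obtain rfl | hkl := eq_or_ne k l
    · simp [Finset.sum_ite_eq']
    · have (x : Fin n) : ¬ (x = k ∧ x = l) := fun h => hkl (h.1.symm.trans h.2)
      simp [hkl, this]
  have hM_sum : M + M =
      ∑ i, ∑ j, (Matrix.single i j (M i j) + Matrix.single j i (star (M i j))) := by
    simp only [hstar, Finset.sum_add_distrib]
    rw [Finset.sum_comm (f := fun i j => Matrix.single j i (M j i)),
      ← Matrix.matrix_eq_sum_single]
  have hD_sum : Matrix.diagonal (fun j => ∑ i, cstarAbs (M i j)) +
        Matrix.diagonal (fun j => ∑ i, cstarAbs (M i j)) =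
      ∑ i, ∑ j, (Matrix.single i i (cstarAbs (star (M i j))) +
        Matrix.single j j (cstarAbs (M i j))) := by
    simp only [hstar, Finset.sum_add_distrib]
    rw [Finset.sum_comm (f := fun i j => Matrix.single i i (cstarAbs (M j i))), ← hdiag]
  rw [hM_sum, hD_sum]
  simp only [ofMatrix_sum]
  exact Finset.sum_le_sum fun i _ => Finset.sum_le_sum fun j _ =>
    single_add_single_star_le i j fun h => by subst h; exact hstar i i

theorem CStarMatrix.le_diagonal_sum_cstarAbs {M : Matrix (Fin n) (Fin n) A}
    (hM : IsSelfAdjoint M) :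
    CStarMatrix.ofMatrix M ≤
      CStarMatrix.ofMatrix (Matrix.diagonal (fun j => ∑ i, cstarAbs (M i j))) :=
  CStarAlgebra.le_of_add_self_le_add_self (add_self_le_diagonal_add_diagonal hM)

end

/-- Lemma 2.7: every self-adjoint `n × n` matrix `(a_{ij})` over a C*-algebra `A` satisfies
`(a_{ij}) ≤ diag(a, …, a)` in `Mₙ(A)`, where `a = ∑_{i,j} |a_{ij}|`. -/
theorem selfAdjoint_matrix_le_diagonal {A : Type*} [NonUnitalCStarAlgebra A] [PartialOrder A]
    [StarOrderedRing A] (n : ℕ) (M : Matrix (Fin n) (Fin n) A) (hM : IsSelfAdjoint M) :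
    MatrixIsPositive
      (Matrix.diagonal (fun _ => ∑ i : Fin n, ∑ j : Fin n, cstarAbs (M i j)) - M) := by
  rw [matrixIsPositive_iff_nonneg, ← CStarMatrix.of_sub_of, sub_nonneg]
  refine (CStarMatrix.le_diagonal_sum_cstarAbs hM).trans ?_
  rw [← sub_nonneg, CStarMatrix.of_sub_of, Matrix.diagonal_sub]
  refine CStarMatrix.ofMatrix_diagonal_nonneg fun k => sub_nonneg.mpr ?_
  exact Finset.sum_le_sum fun i _ =>
    Finset.single_le_sum (fun j _ => cstarAbs_nonneg (M i j)) (Finset.mem_univ k)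
end

section
/- Let A be a unital C*-algebra and let a ∈ A be a nonzero self-adjoint element that is not invertible. Then for every ε > 0 there exists a nonzero self-adjoint element a' ∈ A such that ‖a − a'‖ < ε and a' is a zero divisor, i.e., there exists a nonzero element b ∈ A with a'b = 0 = ba'. -/
/-- Lemma 3.3: in a unital C*-algebra, every nonzero non-invertible self-adjoint element can be
approximated by nonzero self-adjoint zero divisors. -/
theorem selfAdjoint_noninvertible_approx_zero_divisor
    {A : Type*} [CStarAlgebra A] (a : A) (ha : IsSelfAdjoint a) (ha0 : a ≠ 0)
    (hna : ¬ IsUnit a) (ε : ℝ) (hε : 0 < ε) :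
    ∃ a' : A, IsSelfAdjoint a' ∧ a' ≠ 0 ∧ ‖a - a'‖ < ε ∧
      ∃ b : A, b ≠ 0 ∧ a' * b = 0 ∧ b * a' = 0 := by
  obtain ⟨δ, hδ, hδm⟩ := exists_between (lt_min hε (norm_pos_iff.mpr ha0))
  obtain ⟨hδε, hδa⟩ := lt_min_iff.mp hδm
  -- Soft thresholding at level `δ`, and a bump at `0` supported in `[-δ, δ]`.
  set f : ℝ → ℝ := fun x ↦ x - max (-δ) (min x δ) with hf
  set g : ℝ → ℝ := fun x ↦ max 0 (δ - |x|) with hg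
  have hfc : Continuous f := by fun_prop
  have hgc : Continuous g := by fun_prop
  have hfg (x : ℝ) : f x * g x = 0 := by
    rcases le_total |x| δ with h | h
    · obtain ⟨h₁, h₂⟩ := abs_le.mp h
      simp [hf, h₁, h₂]
    · simp [hg, h]
  have hmul : cfc f a * cfc g a = 0 := by
    rw [← cfc_mul f g a hfc.continuousOn hgc.continuousOn]
    simp [hfg]
  have hdist : ‖a - cfc f a‖ ≤ δ := by
    nth_rewrite 1 [← cfc_id' ℝ a]
    rw [← cfc_sub (fun x : ℝ ↦ x) f a continuousOn_id hfc.continuousOn]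
    refine norm_cfc_le hδ.le fun x _ ↦ ?_
    rw [hf, sub_sub_cancel, Real.norm_eq_abs, abs_le]
    exact ⟨le_max_left _ _, max_le (by linarith) (min_le_right _ _)⟩
  refine ⟨cfc f a, cfc_predicate f a, fun h ↦ ?_, hdist.trans_lt hδε, cfc g a, fun h ↦ ?_,
    hmul, (cfc_commute_cfc g f a).eq.trans hmul⟩
  · rw [h, sub_zero] at hdist
    exact hdist.not_gt hδa
  · have h0 : (0 : ℝ) ∈ spectrum ℝ a := spectrum.zero_mem ℝ hna
    have := norm_apply_le_norm_cfc g a h0 hgc.continuousOn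
    rw [h, norm_zero, norm_le_zero_iff] at this
    simp [hg] at this
    linarith
end

section
/- Let A be a simple unital C*-algebra with the following tracial approximation property: for every finite subset F ⊆ A, every ε > 0, and every nonzero positive element a ∈ A, there exist a projection p ∈ A and a closed *-subalgebra D of A whose elements all lie in pAp, which contains p as a multiplicative unit, and which has real rank zero as a C*-algebra, such that (1) ‖p b − b p‖ < ε for all b ∈ F; (2) for every b ∈ F there is d ∈ D with ‖p b p − d‖ < ε; and (3) 1 − p ≾ a in A (Cuntz subequivalence). Then A has real rank zero. -/
open Filter Topology

theorem exists_corner_inverse {A : Type*} [NormedRing A] [CompleteSpace A] {s t : A}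
    (hs : s * s = s) (hst : s * t = t) (hts : t * s = t) (h : ‖s - t‖ < 1) :
    ∃ k : A, s * k = k ∧ k * s = k ∧ k * t = s ∧ t * k = s := by
  set v := Units.oneSub (s - t) h with hv
  have hval : (v : A) = 1 - (s - t) := rfl
  have hsv : s * (v : A) = t := by rw [hval]; linear_combination (norm := noncomm_ring) hst - hs
  have hvs : (v : A) * s = t := by rw [hval]; linear_combination (norm := noncomm_ring) hts - hs
  have hc : s * (↑v⁻¹ : A) = (↑v⁻¹ : A) * s :=
    (Commute.units_inv_right (show Commute s (v : A) from hsv.trans hvs.symm)).eq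
  refine ⟨s * (↑v⁻¹ : A), ?_, ?_, ?_, ?_⟩
  · rw [← mul_assoc, hs]
  · rw [mul_assoc, ← hc, ← mul_assoc, hs]
  · rw [mul_assoc, ← hvs, Units.inv_mul_cancel_left, hs]
  · rw [← mul_assoc, hts, ← hsv, Units.mul_inv_cancel_right]

/-- If `y₀ = d + z` is block diagonal with `d` invertible in the corner at `1 - s`, and
`s` is equivalent (through `U`, `V`) to an idempotent below `r`, then the Schur complement
of `y₀` with respect to `r`, suitably bordered, is right invertible. -/
theorem bordered_schur_complement_mul {R : Type*} [Ring R]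
    {y₀ c z s r k U U' V V' q q' : R}
    (hr : r * r = r) (hyc : y₀ * c = 1 - s) (hsc : s * c = 0) (hys : y₀ * s = z)
    (hsz : s * z = z) (hkr : k * r = k) (hky : k * (r * y₀ * r) = r)
    (hUr : U * r = U) (hU's : U' * s = U')
    (hsV : s * V = V) (hrV' : r * V' = V')
    (hUV : U * V' = s) (hUq : U * q' = 0) (hqr : q * r = q) (hrq' : r * q' = q')
    (hqV : q * V' = 0) (hqq : q * q' = r - U' * V) :
    ((1 - r) * y₀ * (1 - r) + ((1 - r) * U + U' * (1 - r))
        - ((1 - r) * y₀ + U') * k * (y₀ * (1 - r) + U) + q) *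
      ((1 - r) * c * (1 - r) + ((1 - r) * V + V' * (1 - r)) - V' * z * V + q') = 1 := by
  obtain ⟨e, he⟩ : ∃ e : R, e = 1 - r := ⟨_, rfl⟩
  rw [← he]
  obtain ⟨Y, hY⟩ : ∃ Y : R, Y = e * c * e + (e * V + V' * e) - V' * z * V + q' := ⟨_, rfl⟩
  rw [← hY]
  have hre : r = 1 - e := by rw [he]; abel
  have hee : e * e = e := by rw [he]; linear_combination (norm := noncomm_ring) hr
  have hUe : U * e = 0 := by rw [he]; linear_combination (norm := noncomm_ring) -hUr
  have hqe : q * e = 0 := by rw [he]; linear_combination (norm := noncomm_ring) -hqr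
  have hke : k * e = 0 := by rw [he]; linear_combination (norm := noncomm_ring) -hkr
  have heV' : e * V' = 0 := by rw [he]; linear_combination (norm := noncomm_ring) -hrV'
  have heq' : e * q' = 0 := by rw [he]; linear_combination (norm := noncomm_ring) -hrq'
  have hU'c : U' * c = 0 := by rw [← hU's, mul_assoc, hsc, mul_zero]
  have hyV : y₀ * V = z * V := by rw [← hys, mul_assoc, hsV]
  have heY : e * Y = e * c * e + e * V := by
    rw [hY]
    linear_combination (norm := noncomm_ring)
      hee * (c * e + V) + heV' * (e - z * V) + heq'
  have hUY : U * Y = s * e - z * V := by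
    rw [hY]
    linear_combination (norm := noncomm_ring)
      hUe * (c * e + V) + hUV * (e - z * V) + hUq - hsz * V
  have hqY : q * Y = r - U' * V := by
    rw [hY]
    linear_combination (norm := noncomm_ring)
      hqe * (c * e + V) + hqV * (e - z * V) + hqq
  have hmY : (y₀ * e + U) * Y = e - y₀ * r * (c * e + V) := by
    rw [add_mul, mul_assoc, heY, hUY, hre]
    linear_combination (norm := noncomm_ring) hyc * e + hyV
  have hky' : k * y₀ * r = r := by
    linear_combination (norm := noncomm_ring) hky - hkr * (y₀ * r)
  have hkmY : k * (y₀ * e + U) * Y = - (r * (c * e + V)) := by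
    rw [mul_assoc, hmY]
    linear_combination (norm := noncomm_ring) hke - hky' * (c * e + V)
  have key : (e * y₀ * e + (e * U + U' * e) - (e * y₀ + U') * k * (y₀ * e + U) + q) * Y
      = e * y₀ * (e * Y) + e * (U * Y) + U' * (e * Y)
        - (e * y₀ + U') * (k * (y₀ * e + U) * Y) + q * Y := by noncomm_ring
  rw [key, heY, hUY, hqY, hkmY, hre]
  linear_combination (norm := noncomm_ring) e * hyc * e + e * hyV + hU'c * e + hee

theorem IsProjection.one_sub {A : Type*} [CStarAlgebra A] {p : A} (hp : IsProjection p) :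
    IsProjection (1 - p) :=
  ⟨(IsSelfAdjoint.one A).sub hp.1, by linear_combination (norm := noncomm_ring) hp.2⟩

theorem IsProjection.exists_corner_inverse {A : Type*} [CStarAlgebra A] {s t : A}
    (hs : IsProjection s) (hst : s * t = t) (hts : t * s = t) (ht : IsSelfAdjoint t)
    (h : ‖s - t‖ ≤ 1 / 2) :
    ∃ k : A, IsSelfAdjoint k ∧ s * k = k ∧ k * s = k ∧ k * t = s ∧ t * k = s ∧ ‖k‖ ≤ 2 := by
  obtain ⟨k, hsk, hks, hkt, htk⟩ := _root_.exists_corner_inverse hs.2 hst hts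
    (h.trans_lt (by norm_num))
  have hk : star k * t = s := by
    rw [← hs.1.star_eq, ← htk, star_mul, ht.star_eq]
  have hk' : star k * s = star k := by
    conv_lhs => rw [← hs.1.star_eq]
    rw [← star_mul, hsk]
  refine ⟨k, ?_, hsk, hks, hkt, htk, ?_⟩
  · show star k = k
    rw [← hk', ← htk, ← mul_assoc, hk, hsk]
  · have e : k = s + k * (s - t) := by
      linear_combination (norm := noncomm_ring) -hks + hkt
    have h1 : ‖k‖ ≤ ‖s‖ + ‖k‖ * ‖s - t‖ := by
      conv_lhs => rw [e]
      exact (norm_add_le _ _).trans (by gcongr; exact norm_mul_le _ _)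
    nlinarith [hs.norm_le_one, norm_nonneg k]

/-- A projection Cuntz below `h * h` is equivalent to a projection of the form `h * _ * h`. -/
theorem CuntzSubeq.exists_equivalence {A : Type*} [CStarAlgebra A] {s h : A}
    (hs : IsProjection s) (hh : IsSelfAdjoint h) (hsub : CuntzSubeq s (h * h)) :
    ∃ u k b : A, IsSelfAdjoint k ∧ u = b * h ∧ s * u = u ∧ s * k = k ∧ k * s = k ∧
      u * star u * k = s ∧ ‖u‖ ≤ 2 := by
  obtain ⟨v, hv⟩ := hsub
  obtain ⟨n, hn⟩ := (hv.eventually (gt_mem_nhds (show (0 : ℝ) < 1 / 2 by norm_num))).exists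
  obtain ⟨u, hu⟩ : ∃ u : A, u = s * v n * h := ⟨_, rfl⟩
  have hsu : s * u = u := by rw [hu, ← mul_assoc, ← mul_assoc, hs.2]
  have hus : star u * s = star u := by
    conv_lhs => rw [← hs.1.star_eq]
    rw [← star_mul, hsu]
  have hsn := hs.norm_le_one
  have hst : ‖s - u * star u‖ ≤ 1 / 2 := by
    have e : s - u * star u = s * (s - v n * (h * h) * star (v n)) * s := by
      rw [hu, star_mul, star_mul, hs.1.star_eq, hh.star_eq]
      linear_combination (norm := noncomm_ring) -hs.2 - hs.2 * s
    rw [e]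
    calc _ ≤ ‖s‖ * ‖s - v n * (h * h) * star (v n)‖ * ‖s‖ :=
          (norm_mul_le _ _).trans (by gcongr; exact norm_mul_le _ _)
      _ ≤ 1 * (1 / 2) * 1 := by gcongr
      _ = 1 / 2 := by norm_num
  obtain ⟨k, hk, hsk, hks, -, htk, -⟩ := hs.exists_corner_inverse
    (t := u * star u) (by rw [← mul_assoc, hsu]) (by rw [mul_assoc, hus])
    (IsSelfAdjoint.mul_star_self u) hst
  refine ⟨u, k, s * v n, hk, hu, hsu, hsk, hks, htk, ?_⟩
  have h1 : ‖u‖ * ‖u‖ = ‖u * star u‖ := (CStarRing.norm_self_mul_star).symm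
  have h2 : ‖u * star u‖ ≤ ‖s‖ + ‖s - u * star u‖ := by
    rw [norm_sub_rev]
    simpa using norm_add_le s (u * star u - s)
  nlinarith [norm_nonneg u]

theorem norm_mul_mul_le_of_le {A : Type*} [NormedRing A] {a b c : A} {α β γ : ℝ}
    (ha : ‖a‖ ≤ α) (hb : ‖b‖ ≤ β) (hc : ‖c‖ ≤ γ) : ‖a * b * c‖ ≤ α * β * γ := by
  have hα := (norm_nonneg a).trans ha
  have hβ := (norm_nonneg b).trans hb
  calc ‖a * b * c‖ ≤ ‖a‖ * ‖b‖ * ‖c‖ :=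
        (norm_mul_le _ _).trans (by gcongr; exact norm_mul_le _ _)
    _ ≤ α * β * γ := by gcongr

theorem norm_sub_corners_le {A : Type*} [CStarAlgebra A] {p w d : A} {ε δ : ℝ}
    (hp : IsProjection p) (hcomm : ‖p * w - w * p‖ < ε) (hd : ‖p * w * p - d‖ < δ) :
    ‖w - (d + (1 - p) * w * (1 - p))‖ ≤ 2 * ε + δ := by
  have e : w - (d + (1 - p) * w * (1 - p)) =
      (p * (p * w - w * p) * (1 - p) - (1 - p) * (p * w - w * p) * p) + (p * w * p - d) := by
    linear_combination (norm := noncomm_ring) -(hp.2 * (w * (1 - p)))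
      - (1 - p) * w * hp.2 - p * w * hp.2 - hp.2 * (w * p)
  rw [e]
  have h1 := norm_mul_mul_le_of_le hp.norm_le_one hcomm.le hp.one_sub.norm_le_one
  have h2 := norm_mul_mul_le_of_le hp.one_sub.norm_le_one hcomm.le hp.norm_le_one
  have h3 := norm_add_le (p * (p * w - w * p) * (1 - p) - (1 - p) * (p * w - w * p) * p)
    (p * w * p - d)
  have h4 := norm_sub_le (p * (p * w - w * p) * (1 - p)) ((1 - p) * (p * w - w * p) * p)
  linarith

theorem exists_invertible_near_compression {A : Type*} [CStarAlgebra A] {p w d₀ : A} {ε : ℝ}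
    (S : NonUnitalStarSubalgebra ℂ A)
    (hS : ∀ d ∈ S, IsSelfAdjoint d → ∀ δ : ℝ, 0 < δ →
      ∃ d' ∈ S, IsSelfAdjoint d' ∧ (∃ c ∈ S, d' * c = p ∧ c * d' = p) ∧ ‖d - d'‖ < δ)
    (hp : IsProjection p) (hw : IsSelfAdjoint w) (hd₀ : d₀ ∈ S) (h : ‖p * w * p - d₀‖ < ε) :
    ∃ d ∈ S, IsSelfAdjoint d ∧ (∃ c ∈ S, d * c = p ∧ c * d = p) ∧ ‖p * w * p - d‖ < 2 * ε := by
  have hpw : IsSelfAdjoint (p * w * p) := by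
    simpa only [hp.1.star_eq] using hw.conjugate p
  have hε : 0 < ε := (norm_nonneg _).trans_lt h
  obtain ⟨d, hd, hdsa, hc, hdist⟩ := hS (realPart d₀ : A)
    (by
      rw [realPart_apply_coe]
      have := SMulMemClass.smul_mem ((2⁻¹ : ℝ) : ℂ) (add_mem hd₀ (star_mem hd₀))
      rwa [Complex.coe_smul] at this) (realPart d₀).2 ε hε
  refine ⟨d, hd, hdsa, hc, ?_⟩
  have e : ‖p * w * p - (realPart d₀ : A)‖ ≤ ‖p * w * p - d₀‖ := by
    have := realPart.norm_le (p * w * p - d₀)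
    rw [map_sub] at this
    have h2 : (realPart (p * w * p) : A) = p * w * p := hpw.coe_realPart
    simpa [h2] using this
  have := norm_sub_le_norm_sub_add_norm_sub (p * w * p) (realPart d₀ : A) d
  linarith

theorem IsSelfAdjoint.isUnit_of_mul_eq_one {A : Type*} [Monoid A] [StarMul A] {y b : A}
    (hy : IsSelfAdjoint y) (h : y * b = 1) : IsUnit y := by
  have h' : star b * y = 1 := by
    rw [← hy.star_eq, ← star_mul, h, star_one]
  exact isUnit_iff_exists.2 ⟨b, h, left_inv_eq_right_inv h' h ▸ h'⟩

/-- Pushing the spectrum of `x` near `0` to `0` leaves room for an orthogonal element. -/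
theorem IsSelfAdjoint.exists_orthogonal_approx {A : Type*} [CStarAlgebra A] {x : A}
    (hx : IsSelfAdjoint x) {κ : ℝ} (hκ : 0 < κ) :
    ∃ x' h : A, IsSelfAdjoint x' ∧ IsSelfAdjoint h ∧ ‖x - x'‖ ≤ κ ∧ h * x' = 0 ∧
      (h = 0 → IsUnit x) := by
  have hg : Continuous fun t : ℝ => max (t - κ) 0 - max (-κ - t) 0 := by fun_prop
  have hf : Continuous fun t : ℝ => max (κ - |t|) 0 := by fun_prop
  refine ⟨cfc (fun t : ℝ => max (t - κ) 0 - max (-κ - t) 0) x,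
    cfc (fun t : ℝ => max (κ - |t|) 0) x, cfc_predicate _ x, cfc_predicate _ x, ?_, ?_, ?_⟩
  · conv_lhs => enter [1, 1]; rw [← cfc_id ℝ x]
    rw [← cfc_sub _ _ x continuousOn_id hg.continuousOn]
    refine norm_cfc_le hκ.le fun t _ => ?_
    rw [Real.norm_eq_abs, abs_le, id]
    constructor <;> rcases max_cases (t - κ) 0 with h | h <;>
      rcases max_cases (-κ - t) 0 with h' | h' <;> linarith
  · rw [← cfc_mul _ _ x hf.continuousOn hg.continuousOn]
    convert cfc_zero ℝ x using 2
    ext t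
    rcases le_or_gt κ |t| with h | h
    · simp [h]
    · rw [abs_lt] at h
      rw [max_eq_right (by linarith : t - κ ≤ 0), max_eq_right (by linarith : -κ - t ≤ 0)]
      simp
  · intro h0
    rw [← spectrum.zero_notMem_iff ℝ]
    intro hmem
    have h1 := cfc_map_spectrum (fun t : ℝ => max (κ - |t|) 0) x hx hf.continuousOn
    have hnt : Nontrivial A := by
      by_contra hn
      rw [not_nontrivial_iff_subsingleton] at hn
      simp [spectrum.of_subsingleton] at hmem
    rw [h0, spectrum.zero_eq] at h1
    have h2 : max (κ - |(0 : ℝ)|) 0 ∈ ({0} : Set ℝ) := h1 ▸ ⟨0, hmem, rfl⟩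
    simp at h2
    linarith

theorem CuntzSubeq.exists_isUnit_near {A : Type*} [CStarAlgebra A] {x r p d c : A} {δ : ℝ}
    (hx : IsSelfAdjoint x) (hr : IsProjection r) (hrx : r * x = 0) (hp : IsProjection p)
    (hd : IsSelfAdjoint d) (hdp : d * p = d) (hpc : p * c = c) (hdc : d * c = p)
    (hδ : 0 < δ) (hδ' : δ ≤ 1 / 2)
    (hnear : ‖(x + r) - (d + (1 - p) * (x + r) * (1 - p))‖ ≤ δ)
    (hsub : CuntzSubeq (1 - p) r) :
    ∃ y : A, IsSelfAdjoint y ∧ IsUnit y ∧ ‖x - y‖ ≤ 25 * δ := by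
  obtain ⟨s, hs⟩ : ∃ s : A, s = 1 - p := ⟨_, rfl⟩
  have hsp : IsProjection s := hs ▸ hp.one_sub
  rw [← hs] at hsub hnear
  obtain ⟨u, l, b, hl, hub, hsu, hsl, hls, hul, hun⟩ :=
    CuntzSubeq.exists_equivalence hsp hr.1 (hr.2.symm ▸ hsub)
  obtain ⟨z, hz⟩ : ∃ z : A, z = s * (x + r) * s := ⟨_, rfl⟩
  obtain ⟨y₀, hy₀⟩ : ∃ y₀ : A, y₀ = d + z := ⟨_, rfl⟩
  rw [← hz, ← hy₀] at hnear
  have hz_sa : IsSelfAdjoint z := by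
    have := (hx.add hr.1).conjugate s
    rwa [hsp.1.star_eq, ← hz] at this
  have hy₀_sa : IsSelfAdjoint y₀ := hy₀ ▸ hd.add hz_sa
  have hxr : x * r = 0 := by
    rw [← hx.star_eq, ← hr.1.star_eq, ← star_mul, hrx, star_zero]
  have hrn := hr.norm_le_one
  have hsz : s * z = z := by rw [hz, ← mul_assoc, ← mul_assoc, hsp.2]
  have hzs : z * s = z := by rw [hz, mul_assoc, hsp.2]
  have hsc : s * c = 0 := by rw [hs, sub_mul, one_mul, hpc, sub_self]
  have hds : d * s = 0 := by rw [hs, mul_sub, mul_one, hdp, sub_self]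
  have hzc : z * c = 0 := by rw [← hzs, mul_assoc, hsc, mul_zero]
  have hyc : y₀ * c = 1 - s := by rw [hy₀, add_mul, hzc, hdc, hs]; abel
  have hys : y₀ * s = z := by rw [hy₀, add_mul, hds, hzs, zero_add]
  have hry_sa : IsSelfAdjoint (r * y₀ * r) := by
    simpa only [hr.1.star_eq] using hy₀_sa.conjugate r
  obtain ⟨k, hk, hrk, hkr, hky, -, hkn⟩ := hr.exists_corner_inverse (t := r * y₀ * r)
    (by rw [← mul_assoc, ← mul_assoc, hr.2]) (by rw [mul_assoc, hr.2]) hry_sa (by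
      have e : r - r * y₀ * r = r * (x + r - y₀) * r := by
        linear_combination (norm := noncomm_ring) -(hrx * r) - hr.2 - hr.2 * r
      rw [e]
      exact (norm_mul_mul_le_of_le hrn hnear hrn).trans (by linarith))
  have hur : u * r = u := by rw [hub, mul_assoc, hr.2]
  have hru : r * star u = star u := by
    conv_lhs => rw [← hr.1.star_eq]
    rw [← star_mul, hur]
  have hus : star u * s = star u := by
    conv_lhs => rw [← hsp.1.star_eq]
    rw [← star_mul, hsu]
  obtain ⟨g, hg⟩ : ∃ g : A, g = r - star u * l * u := ⟨_, rfl⟩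
  have hug : u * g = 0 := by
    rw [hg]
    linear_combination (norm := noncomm_ring) hur - hul * u - hsu
  have hgu : g * (star u * l) = 0 := by
    rw [hg]
    linear_combination (norm := noncomm_ring) hru * l - star u * l * hul - star u * hls
  have hrg : r * g = g := by
    rw [hg]
    linear_combination (norm := noncomm_ring) hr.2 - hru * (l * u)
  have hg_sa : IsSelfAdjoint g := by
    have := hl.conjugate' u
    rw [hg]
    exact hr.1.sub this
  have hgr : g * r = g := by
    rw [← hg_sa.star_eq, ← hr.1.star_eq, ← star_mul, hrg]
  have hgg : g * g = g := by
    conv_lhs => enter [2]; rw [hg]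
    linear_combination (norm := noncomm_ring) hgr - hgu * u
  have hgn : ‖g‖ ≤ 1 := IsProjection.norm_le_one ⟨hg_sa, hgg⟩
  have hδ0 := hδ.ne'
  have hmul := bordered_schur_complement_mul (y₀ := y₀) (c := c) (z := z) (s := s) (r := r)
    (k := k) (U := δ • u) (U' := δ • star u) (V := δ⁻¹ • (l * u)) (V' := δ⁻¹ • (star u * l))
    (q := δ • g) (q' := δ⁻¹ • g) hr.2 hyc hsc hys hsz hkr hky
    (by rw [smul_mul_assoc, hur]) (by rw [smul_mul_assoc, hus])
    (by rw [mul_smul_comm, ← mul_assoc, hsl]) (by rw [mul_smul_comm, ← mul_assoc, hru])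
    (by rw [smul_mul_smul_comm, mul_inv_cancel₀ hδ0, one_smul, ← mul_assoc, hul])
    (by rw [smul_mul_smul_comm, hug, smul_zero])
    (by rw [smul_mul_assoc, hgr]) (by rw [mul_smul_comm, hrg])
    (by rw [smul_mul_smul_comm, hgu, smul_zero])
    (by rw [smul_mul_smul_comm, smul_mul_smul_comm, mul_inv_cancel₀ hδ0, one_smul, one_smul, hgg,
          hg, mul_assoc])
  obtain ⟨e, he⟩ : ∃ e : A, e = 1 - r := ⟨_, rfl⟩
  rw [← he] at hmul
  have hep : IsProjection e := he ▸ hr.one_sub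
  have hen := hep.norm_le_one
  have hy_sa : IsSelfAdjoint (e * y₀ * e + (e * δ • u + δ • star u * e)
      - (e * y₀ + δ • star u) * k * (y₀ * e + δ • u) + δ • g) := by
    simp only [IsSelfAdjoint, star_add, star_sub, star_mul, star_smul, star_star, star_trivial,
      hep.1.star_eq, hy₀_sa.star_eq, hk.star_eq, hg_sa.star_eq, mul_assoc]
    abel
  refine ⟨_, hy_sa, hy_sa.isUnit_of_mul_eq_one hmul, ?_⟩
  have hUn : ‖δ • u‖ ≤ 2 * δ := by
    rw [norm_smul, Real.norm_of_nonneg hδ.le]; nlinarith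
  have hU'n : ‖δ • star u‖ ≤ 2 * δ := by
    rw [norm_smul, norm_star, Real.norm_of_nonneg hδ.le]; nlinarith
  have hqn : ‖δ • g‖ ≤ δ := by
    rw [norm_smul, Real.norm_of_nonneg hδ.le]; nlinarith
  have hexe : e * (x + r) * e = x := by
    rw [he]
    linear_combination (norm := noncomm_ring) -hrx - hxr + hrx * r - hr.2 + hr.2 * r
  have hrwe : r * (x + r) * e = 0 := by
    rw [he]
    linear_combination (norm := noncomm_ring) hrx * (1 - r) - hr.2 * r
  have hewr : e * (x + r) * r = 0 := by
    rw [he]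
    linear_combination (norm := noncomm_ring) hxr - hrx * r - hr.2 * r
  generalize δ • u = U at *
  generalize δ • star u = U' at *
  generalize δ • g = q at *
  have decomp : x - (e * y₀ * e + (e * U + U' * e) - (e * y₀ + U') * k * (y₀ * e + U) + q) =
      e * (x + r - y₀) * e - (e * U * 1 + 1 * U' * e)
        + (U' * r - e * (x + r - y₀) * r) * k * (1 * r * U - r * (x + r - y₀) * e) - q := by
    have h1 : (U' * r - e * (x + r - y₀) * r) * k = (e * y₀ + U') * k := by
      linear_combination (norm := noncomm_ring) (e * y₀ + U') * hrk - hewr * k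
    have h2 : k * (1 * r * U - r * (x + r - y₀) * e) = k * (y₀ * e + U) := by
      linear_combination (norm := noncomm_ring) hkr * (y₀ * e + U) - k * hrwe
    rw [h1, mul_assoc _ k (1 * r * U - _), h2]
    linear_combination (norm := noncomm_ring) -hexe
  rw [decomp]
  have hone : ‖(1 : A)‖ ≤ 1 :=
    IsProjection.norm_le_one ⟨IsSelfAdjoint.one A, one_mul 1⟩
  have b1 := norm_mul_mul_le_of_le hen hnear hen
  have b2 := norm_mul_mul_le_of_le hen hUn hone
  have b3 := norm_mul_mul_le_of_le hone hU'n hen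
  have b4 := norm_mul_mul_le_of_le hen hnear hrn
  have b5 := norm_mul_mul_le_of_le hrn hnear hen
  have b6 := norm_mul_mul_le_of_le hone hU'n hrn
  have b7 := norm_mul_mul_le_of_le hone hrn hUn
  rw [one_mul] at b6
  have b8 : ‖U' * r - e * (x + r - y₀) * r‖ ≤ 3 * δ := (norm_sub_le _ _).trans (by linarith)
  have b9 : ‖1 * r * U - r * (x + r - y₀) * e‖ ≤ 3 * δ := (norm_sub_le _ _).trans (by linarith)
  have b10 := norm_mul_mul_le_of_le b8 hkn b9
  refine (norm_sub_le _ _).trans ((add_le_add_left (norm_add_le _ _) _).trans ?_)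
  have b11 := norm_sub_le (e * (x + r - y₀) * e) (e * U * 1 + 1 * U' * e)
  have b12 := norm_add_le (e * U * 1) (1 * U' * e)
  nlinarith

/-- Theorem 3.4: a simple unital C*-algebra which is tracially approximated by unital
C*-algebras of real rank zero has real rank zero. -/
theorem realRankZero_of_tracial_approximation
    {A : Type*} [CStarAlgebra A] [PartialOrder A] [StarOrderedRing A]
    (hA : IsSimpleCStarAlgebra A)
    (hTA : ∀ (F : Finset A) (ε : ℝ), 0 < ε → ∀ a : A, 0 ≤ a → a ≠ 0 →
      ∃ (p : A) (S : NonUnitalStarSubalgebra ℂ A),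
        IsProjection p ∧
        IsClosed (S : Set A) ∧
        p ∈ S ∧
        (∀ d ∈ S, p * d = d ∧ d * p = d) ∧
        -- `D` has real rank zero as a C*-algebra (with unit `p`):
        (∀ d ∈ S, IsSelfAdjoint d → ∀ δ : ℝ, 0 < δ →
          ∃ d' ∈ S, IsSelfAdjoint d' ∧ (∃ c ∈ S, d' * c = p ∧ c * d' = p) ∧ ‖d - d'‖ < δ) ∧
        (∀ b ∈ F, ‖p * b - b * p‖ < ε) ∧
        (∀ b ∈ F, ∃ d ∈ S, ‖p * b * p - d‖ < ε) ∧
        CuntzSubeq (1 - p) a) :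
    ∀ x : A, IsSelfAdjoint x → ∀ ε : ℝ, 0 < ε →
      ∃ y : A, IsSelfAdjoint y ∧ IsUnit y ∧ ‖x - y‖ < ε := by
  intro x hx ε hε
  obtain ⟨x', h, hx', hh, hxx', hhx', hunit⟩ :=
    hx.exists_orthogonal_approx (κ := ε / 4) (by positivity)
  by_cases h0 : h = 0
  · exact ⟨x, hx, hunit h0, by simpa using hε⟩
  have hhh : h * h ≠ 0 := by
    conv_lhs => enter [1]; rw [← hh.star_eq]
    exact mt (CStarRing.star_mul_self_eq_zero_iff h).1 h0
  obtain ⟨p, S, hp, -, -, hpS, hS, -, hF, hsub⟩ :=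
    hTA {x} (ε / 4) (by positivity) (h * h)
      (by simpa only [hh.star_eq] using star_mul_self_nonneg h) hhh
  obtain ⟨u, l, b, hl, hub, hsu, hsl, hls, hul, -⟩ := hsub.exists_equivalence hp.one_sub hh
  obtain ⟨r, hr⟩ : ∃ r : A, r = star u * l * u := ⟨_, rfl⟩
  have hrp : IsProjection r := by
    refine ⟨hr ▸ hl.conjugate' u, ?_⟩
    rw [hr]
    linear_combination (norm := noncomm_ring) star u * l * hul * u + star u * hls * u
  have hrx : r * x' = 0 := by
    rw [hr]
    linear_combination (norm := noncomm_ring) star u * l * hub * x' + star u * l * b * hhx'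
  by_cases hr0 : r = 0
  · have hp1 : 1 - p = 0 := by
      rw [← hp.one_sub.2]
      linear_combination (norm := noncomm_ring) -(hul * (1 - p)) - u * star u * l * hul
        + u * (hr0 - hr) * (star u * l)
    have hp1 : p = 1 := (sub_eq_zero.1 hp1).symm
    subst hp1
    obtain ⟨d₀, hd₀, hd₀x⟩ := hF x (Finset.mem_singleton_self x)
    obtain ⟨d, -, hd, ⟨c, -, hdc, -⟩, hxd⟩ :=
      exists_invertible_near_compression S hS hp hx hd₀ hd₀x
    refine ⟨d, hd, hd.isUnit_of_mul_eq_one hdc, ?_⟩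
    rw [one_mul, mul_one] at hxd
    linarith
  obtain ⟨δ, hδ⟩ : ∃ δ : ℝ, δ = min (ε / 100) (1 / 2) := ⟨_, rfl⟩
  have hδ0 : 0 < δ := hδ ▸ by positivity
  have hδε : δ ≤ ε / 100 := hδ ▸ min_le_left _ _
  obtain ⟨p, S, hp, -, -, hpS, hS, hcomm, hF, hsub⟩ :=
    hTA {x' + r} (δ / 4) (by positivity) r
      (by simpa only [hrp.1.star_eq, hrp.2] using star_mul_self_nonneg r) hr0
  obtain ⟨d₀, hd₀, hd₀x⟩ := hF _ (Finset.mem_singleton_self _)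
  obtain ⟨d, hdS, hd, ⟨c, hcS, hdc, -⟩, hwd⟩ :=
    exists_invertible_near_compression S hS hp (hx'.add hrp.1) hd₀ hd₀x
  have hnear := norm_sub_corners_le hp (hcomm _ (Finset.mem_singleton_self _)) hwd
  obtain ⟨y, hy, hyu, hxy⟩ := hsub.exists_isUnit_near hx' hrp hrx hp hd (hpS d hdS).2
    (hpS c hcS).1 hdc hδ0 (hδ ▸ min_le_right _ _) (hnear.trans (by linarith))
  refine ⟨y, hy, hyu, ?_⟩
  have := norm_sub_le_norm_sub_add_norm_sub x x' y
  linarith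
end
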